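/- arXiv:1207.3462 — 4 statements merged into one kernel-verified Lean document; each statement's English description precedes it below -/
import Mathlib

section
/- Let f_h^n be the number of nonisomorphic n-element semiorders of length exactly h. Then for n ≥ 2, f_3^n = 3·f_3^{n−1} + f_2^{n−2} + f_1^{n−2}. -/
namespace Paper

/-- Two elements are incomparable. -/
def Incomp {α : Type*} [PartialOrder α] (a b : α) : Prop := ¬ a ≤ b ∧ ¬ b ≤ a

/-- A semiorder: no induced `2+2` and no induced `3+1`. -/
def IsSemiorder (α : Type*) [PartialOrder α] : Prop :=
  (¬ ∃ x y z w : α, y < x ∧ w < z ∧ Incomp x z ∧ Incomp x w ∧ Incomp y z ∧ Incomp y w) ∧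
  (¬ ∃ x y z w : α, z < y ∧ y < x ∧ Incomp x w ∧ Incomp y w ∧ Incomp z w)

/-- There is a chain of `k` elements. -/
def HasChain (α : Type*) [Preorder α] (k : ℕ) : Prop := ∃ c : Fin k → α, StrictMono c

/-- The length of a longest chain (number of edges) is exactly `H`. -/
def HasLength (α : Type*) [Preorder α] (H : ℕ) : Prop :=
  HasChain α (H + 1) ∧ ¬ HasChain α (H + 2)

/-- There is a chain of `k` elements all strictly above `a`. -/
def HasChainAbove {α : Type*} [Preorder α] (a : α) (k : ℕ) : Prop :=
  ∃ c : Fin k → α, StrictMono c ∧ ∀ j, a < c j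

/-- `a` is on the `i`-th level (`i ≥ 1`). -/
def OnLevel {α : Type*} [Preorder α] (a : α) (i : ℕ) : Prop :=
  1 ≤ i ∧ HasChainAbove a (i - 1) ∧ ¬ HasChainAbove a i

/-- Number of isomorphism classes of partial orders on `Fin n` satisfying `pred`. -/
noncomputable def countPosets (n : ℕ) (pred : PartialOrder (Fin n) → Prop) : ℕ :=
  Nat.card (Quot (fun (P Q : {P : PartialOrder (Fin n) // pred P}) =>
    ∃ e : Fin n ≃ Fin n, ∀ a b : Fin n,
      (@LE.le _ P.1.toPreorder.toLE a b ↔ @LE.le _ Q.1.toPreorder.toLE (e a) (e b))))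

/-- Semiorder of length exactly `H`. -/
def SemiLen (n H : ℕ) (P : PartialOrder (Fin n)) : Prop :=
  @IsSemiorder (Fin n) P ∧ @HasLength (Fin n) P.toPreorder H

/-- Semiorder of length at most `h`. -/
def SemiLenLe (n h : ℕ) (P : PartialOrder (Fin n)) : Prop :=
  @IsSemiorder (Fin n) P ∧ ¬ @HasChain (Fin n) P.toPreorder (h + 2)

/-- `f_H^n`. -/
noncomputable def fEx (H n : ℕ) : ℕ := countPosets n (SemiLen n H)

/-- `f_{≤h}^n`. -/
noncomputable def fLe (h n : ℕ) : ℕ := countPosets n (SemiLenLe n h)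

/-- Ordered (plane) trees. -/
inductive PTree where
  | node : List PTree → PTree

def PTree.size : PTree → ℕ
  | .node cs => 1 + (cs.attach.map fun c => PTree.size c.1).sum
decreasing_by have := List.sizeOf_lt_of_mem c.2; simp only [PTree.node.sizeOf_spec] at *; omega

def PTree.height : PTree → ℕ
  | .node cs => (cs.attach.map fun c => PTree.height c.1 + 1).foldr max 0
decreasing_by have := List.sizeOf_lt_of_mem c.2; simp only [PTree.node.sizeOf_spec] at *; omega

def PTree.countDepth : PTree → ℕ → ℕ
  | .node _, 0 => 1
  | .node cs, d + 1 => (cs.attach.map fun c => PTree.countDepth c.1 d).sum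
termination_by t _ => sizeOf t
decreasing_by have := List.sizeOf_lt_of_mem c.2; simp only [PTree.node.sizeOf_spec] at *; omega

/-- Value of a path after the steps in `l` (`true` = up-step, `false` = down-step). -/
def pathVal (l : List Bool) : ℤ := (l.map fun b => if b then (1 : ℤ) else -1).sum

/-- `l` is a Dyck path. -/
def IsDyckPath (l : List Bool) : Prop :=
  pathVal l = 0 ∧ ∀ p, p <+: l → 0 ≤ pathVal p

/-- The height of the path `l` is exactly `H`. -/
def DyckHeightIs (l : List Bool) (H : ℕ) : Prop :=
  (∃ p, p <+: l ∧ pathVal p = H) ∧ ∀ p, p <+: l → pathVal p ≤ (H : ℤ)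

/-- Number of peaks of a path. -/
def peaks (l : List Bool) : ℕ :=
  ((List.range l.length).filter fun i => l.getD i false && !(l.getD (i + 1) true)).length

/-! ### Valid lists and their blocks -/

/-- Weakly decreasing lists of naturals in which every entry is at most the number of entries
after it. -/
def Valid : List ℕ → Prop
  | [] => True
  | x :: l => x ≤ l.length ∧ l.headD 0 ≤ x ∧ Valid l

/-- The list `l` has at most `k` blocks, where the first block of `x :: l` consists of all but
the last `x` entries. -/
def Short : ℕ → List ℕ → Prop
  | 0, l => l = []
  | _ + 1, [] => True
  | k + 1, _x :: l => Short k (l.drop (l.length - _x))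

theorem Short.succ {k : ℕ} {l : List ℕ} (h : Short k l) : Short (k + 1) l := by
  induction k generalizing l with
  | zero => rw [Short] at h; subst h; simp [Short]
  | succ k ih =>
    cases l with
    | nil => simp [Short]
    | cons x l => exact ih (l := l.drop (l.length - x)) h

theorem finite_valid (n : ℕ) : {l : List ℕ | Valid l ∧ l.length = n}.Finite := by
  induction n with
  | zero => exact (Set.finite_singleton []).subset fun l hl => by simpa using hl.2
  | succ n ih =>
    refine (Set.Finite.image2 List.cons (Set.finite_Iic n) ih).subset ?_
    rintro (_ | ⟨x, l⟩) ⟨hv, hl⟩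
    · simp at hl
    · simp only [List.length_cons, add_left_inj] at hl
      exact ⟨x, by simpa [← hl] using hv.1, l, ⟨hv.2.2, hl⟩, rfl⟩

/-- Valid lists of length `p + r` with first entry below `u` whose last `p` entries form at most
`k` blocks. -/
def validSet (k p r u : ℕ) : Set (List ℕ) :=
  {l | Valid l ∧ l.length = p + r ∧ l.headD 0 < u ∧ Short k (l.drop r)}

theorem finite_validSet (k p r u : ℕ) : (validSet k p r u).Finite :=
  (finite_valid (p + r)).subset fun _ hl => ⟨hl.1, hl.2.1⟩

theorem validSet_zero_right (k p r : ℕ) : validSet k p r 0 = ∅ := by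
  ext l; simp [validSet]

theorem validSet_succ_left {k p r u : ℕ} (hu : u ≤ p) :
    validSet k p (r + 1) (u + 1) =
      List.cons u '' validSet k p r (u + 1) ∪ validSet k p (r + 1) u := by
  ext (_ | ⟨x, l⟩)
  · simp [validSet]
  · simp only [validSet, Set.mem_ofPred_eq, Set.mem_union, Set.mem_image, List.cons.injEq,
      List.length_cons, List.headD_cons, List.drop_succ_cons, Valid]
    constructor
    · rintro ⟨⟨h1, h2, h3⟩, h4, h5, h6⟩
      rcases Nat.lt_succ_iff_lt_or_eq.1 h5 with h | rfl
      · exact Or.inr ⟨⟨h1, h2, h3⟩, h4, h, h6⟩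
      · exact Or.inl ⟨l, ⟨h3, by omega, by omega, h6⟩, rfl, rfl⟩
    · rintro (⟨_, ⟨h1, h2, h3, h4⟩, rfl, rfl⟩ | ⟨⟨h1, h2, h3⟩, h4, h5, h6⟩)
      · exact ⟨⟨by omega, by omega, h1⟩, by omega, by omega, h4⟩
      · exact ⟨⟨h1, h2, h3⟩, h4, by omega, h6⟩

theorem validSet_succ_right {k p u : ℕ} (hu : u ≤ p) :
    validSet (k + 1) (p + 1) 0 (u + 1) =
      List.cons u '' validSet k u (p - u) (u + 1) ∪ validSet (k + 1) (p + 1) 0 u := by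
  ext (_ | ⟨x, l⟩)
  · simp [validSet]
  · simp only [validSet, Set.mem_ofPred_eq, Set.mem_union, Set.mem_image, List.cons.injEq,
      List.length_cons, List.headD_cons, List.drop_zero, Valid, Short]
    constructor
    · rintro ⟨⟨h1, h2, h3⟩, h4, h5, h6⟩
      rcases Nat.lt_succ_iff_lt_or_eq.1 h5 with h | rfl
      · exact Or.inr ⟨⟨h1, h2, h3⟩, h4, h, h6⟩
      · obtain rfl : l.length = p := by omega
        exact Or.inl ⟨l, ⟨h3, by omega, by omega, h6⟩, rfl, rfl⟩
    · rintro (⟨l', ⟨h1, h2, h3, h4⟩, rfl, rfl⟩ | ⟨⟨h1, h2, h3⟩, h4, h5, h6⟩)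
      · obtain rfl : l'.length = p := by omega
        exact ⟨⟨by omega, by omega, h1⟩, by omega, by omega, h4⟩
      · exact ⟨⟨h1, h2, h3⟩, h4, by omega, h6⟩

theorem validSet_zero_zero {k u : ℕ} : validSet k 0 0 (u + 1) = {[]} := by
  ext l
  simp only [validSet, Set.mem_ofPred_eq, List.length_eq_zero_iff, Set.mem_singleton_iff,
    Nat.add_zero]
  constructor
  · exact fun h => h.2.1
  · rintro rfl
    cases k <;> simp [Valid, Short]

theorem validSet_zero_succ (p r u : ℕ) : validSet 0 (p + 1) r u = ∅ := by
  ext l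
  simp only [validSet, Set.mem_ofPred_eq, Short, List.drop_eq_nil_iff, Set.mem_empty_iff_false,
    iff_false]
  omega

theorem validSet_succ_bound (k p : ℕ) :
    validSet k (p + 1) 0 (p + 2) = validSet k (p + 1) 0 (p + 1) := by
  ext (_ | ⟨x, l⟩)
  · simp [validSet]
  · simp only [validSet, Set.mem_ofPred_eq, List.length_cons, List.headD_cons, Valid]
    constructor
    · rintro ⟨⟨h1, h2, h3⟩, h4, h5, h6⟩
      exact ⟨⟨h1, h2, h3⟩, h4, by omega, h6⟩
    · rintro ⟨⟨h1, h2, h3⟩, h4, h5, h6⟩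
      exact ⟨⟨h1, h2, h3⟩, h4, by omega, h6⟩

theorem ncard_cons_union {u : ℕ} {s t : Set (List ℕ)} (hs : s.Finite) (ht : t.Finite)
    (htu : ∀ l ∈ t, l.headD 0 < u) : (List.cons u '' s ∪ t).ncard = s.ncard + t.ncard := by
  rw [Set.ncard_union_eq _ (hs.image _) ht, Set.ncard_image_of_injective _ (List.cons_injective)]
  rw [Set.disjoint_left]
  rintro _ ⟨l, -, rfl⟩ h
  simpa using htu _ h

theorem ncard_validSet_succ_left {k p r u : ℕ} (hu : u ≤ p) :
    (validSet k p (r + 1) (u + 1)).ncard =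
      (validSet k p r (u + 1)).ncard + (validSet k p (r + 1) u).ncard := by
  rw [validSet_succ_left hu,
    ncard_cons_union (finite_validSet _ _ _ _) (finite_validSet _ _ _ _) fun l hl => hl.2.2.1]

theorem ncard_validSet_succ_right {k p u : ℕ} (hu : u ≤ p) :
    (validSet (k + 1) (p + 1) 0 (u + 1)).ncard =
      (validSet k u (p - u) (u + 1)).ncard + (validSet (k + 1) (p + 1) 0 u).ncard := by
  rw [validSet_succ_right hu,
    ncard_cons_union (finite_validSet _ _ _ _) (finite_validSet _ _ _ _) fun l hl => hl.2.2.1]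

/-! ### Generating functions -/

open PowerSeries

/-- Generating function, in the number `p` of entries, of the lists in `validSet` whose first
entry is at most `p - j`. -/
noncomputable def genFun (k r j : ℕ) : PowerSeries ℤ :=
  PowerSeries.mk fun p => ((validSet k p r (p + 1 - j)).ncard : ℤ)

theorem genFun_succ (k r j : ℕ) :
    genFun k (r + 1) j = genFun k r j + genFun k (r + 1) (j + 1) := by
  ext p
  simp only [genFun, coeff_mk, map_add]
  by_cases h : j ≤ p
  · have := ncard_validSet_succ_left (k := k) (p := p) (r := r) (u := p - j) (by omega)
    rw [show p + 1 - j = p - j + 1 by omega, show p + 1 - (j + 1) = p - j by omega, this]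
    push_cast; rfl
  · rw [show p + 1 - j = 0 by omega, show p + 1 - (j + 1) = 0 by omega]
    simp [validSet_zero_right]

theorem genFun_base_zero (k : ℕ) : genFun k 0 0 = 1 + genFun k 0 1 := by
  ext p
  simp only [genFun, coeff_mk, map_add, coeff_one]
  rcases p with _ | p
  · simp [validSet_zero_zero, validSet_zero_right]
  · simp [validSet_succ_bound]

theorem genFun_base_succ (k j : ℕ) :
    genFun (k + 1) 0 (j + 1) = X ^ (j + 1) * genFun k j 0 + genFun (k + 1) 0 (j + 2) := by
  ext p
  simp only [genFun, coeff_mk, map_add, coeff_X_pow_mul']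
  by_cases h : j + 1 ≤ p
  · obtain ⟨q, rfl⟩ := Nat.exists_eq_add_of_le h
    have := ncard_validSet_succ_right (k := k) (p := j + q) (u := q) (by omega)
    simp only [h, if_true]
    rw [show j + 1 + q + 1 - (j + 1) = q + 1 by omega, show j + 1 + q + 1 - (j + 2) = q by omega,
      show j + 1 + q = j + q + 1 by omega, this, show j + q + 1 - (j + 1) = q by omega,
      show j + q - q = j by omega]
    push_cast; rfl
  · rw [show p + 1 - (j + 1) = 0 by omega, show p + 1 - (j + 2) = 0 by omega]
    simp [validSet_zero_right, h]

theorem coeff_genFun_of_lt {k r j p : ℕ} (h : p < j) : coeff p (genFun k r j) = 0 := by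
  rw [genFun, coeff_mk, show p + 1 - j = 0 by omega]
  simp [validSet_zero_right]

theorem eq_zero_of_succ_eq {f : ℕ → PowerSeries ℤ} (hf : ∀ j, f j = f (j + 1))
    (h0 : ∀ j p, p < j → coeff p (f j) = 0) (j : ℕ) : f j = 0 := by
  ext p
  have : ∀ i, f j = f (j + i) := fun i => by
    induction i with
    | zero => rfl
    | succ i ih => rw [ih, hf]; rfl
  rw [this (p + 1), h0 _ _ (by omega), map_zero]

theorem coeff_mul_eq_zero_of_lt {P f : PowerSeries ℤ} {j : ℕ}
    (hf : ∀ p, p < j → coeff p f = 0) (p : ℕ) (hp : p < j) : coeff p (P * f) = 0 := by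
  rw [coeff_mul]
  refine Finset.sum_eq_zero fun x hx => ?_
  rw [Finset.HasAntidiagonal.mem_antidiagonal] at hx
  rw [hf _ (by omega), mul_zero]

/-- Contribution of the lists with first entry exactly `p - j` to `genFun k 0 j`. -/
noncomputable def headGenFun (k j : ℕ) : PowerSeries ℤ := genFun k 0 j - genFun k 0 (j + 1)

theorem mul_genFun_succ {k : ℕ} {P Q : PowerSeries ℤ}
    (h : ∀ j, P * headGenFun k (j + 1) = Q * headGenFun k j) (r j : ℕ) :
    P * genFun k r (j + 1) = Q * genFun k r j := by
  have key : ∀ r, (∀ j, P * (genFun k r (j + 1) - genFun k r (j + 2)) =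
      Q * (genFun k r j - genFun k r (j + 1))) →
      ∀ j, P * genFun k r (j + 1) = Q * genFun k r j := by
    intro r hr j
    rw [← sub_eq_zero]
    refine eq_zero_of_succ_eq (f := fun j => P * genFun k r (j + 1) - Q * genFun k r j)
      (fun j => ?_) (fun j p hp => ?_) j
    · linear_combination hr j
    · rw [map_sub, coeff_mul_eq_zero_of_lt (j := j) _ p hp,
        coeff_mul_eq_zero_of_lt (j := j) _ p hp, sub_zero]
      · exact fun p hp => coeff_genFun_of_lt hp
      · exact fun p hp => coeff_genFun_of_lt (by omega)
  induction r generalizing j with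
  | zero => exact key 0 h j
  | succ r ih =>
    refine key (r + 1) (fun j => ?_) j
    linear_combination ih j + P * genFun_succ k r (j + 1) - Q * genFun_succ k r j

theorem mul_genFun_zero {k : ℕ} {P Q : PowerSeries ℤ}
    (h : ∀ j, P * headGenFun k (j + 1) = Q * headGenFun k j) :
    (P - Q) * genFun k 0 0 = P := by
  linear_combination P * genFun_base_zero k + mul_genFun_succ h 0 0

theorem mul_headGenFun_succ {k : ℕ} {P Q : PowerSeries ℤ}
    (h : ∀ j, P * headGenFun k (j + 1) = Q * headGenFun k j) (j : ℕ) :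
    (P - Q) * headGenFun (k + 1) (j + 1) = X * P * headGenFun (k + 1) j := by
  have h1 : ∀ j, headGenFun (k + 1) (j + 1) = X ^ (j + 1) * genFun k j 0 := fun j => by
    rw [headGenFun, genFun_base_succ, add_sub_cancel_right]
  rcases j with _ | j
  · rw [h1, headGenFun]
    linear_combination X * mul_genFun_zero h - X * P * genFun_base_zero (k + 1)
  · rw [h1, h1]
    linear_combination X ^ (j + 2) * mul_genFun_succ h (j + 1) 0
      + X ^ (j + 2) * P * genFun_succ k j 0

theorem headGenFun_zero_succ (j : ℕ) : headGenFun 0 (j + 1) = 0 := by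
  ext p
  rw [headGenFun, map_sub, genFun, genFun, coeff_mk, coeff_mk]
  rcases p with _ | p
  · simp [validSet_zero_right]
  · simp [validSet_zero_succ]

theorem genFun_relation :
    genFun 4 0 0 - genFun 3 0 0 =
      3 * X * (genFun 4 0 0 - genFun 3 0 0) + X ^ 2 * (genFun 3 0 0 - genFun 1 0 0) := by
  have h0 : ∀ j, (1 : PowerSeries ℤ) * headGenFun 0 (j + 1) = 0 * headGenFun 0 j := fun j => by
    rw [headGenFun_zero_succ]; ring
  have h1 := mul_headGenFun_succ h0
  have h2 := mul_headGenFun_succ h1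
  have h3 := mul_headGenFun_succ h2
  have h4 := mul_headGenFun_succ h3
  have e1 := mul_genFun_zero h1
  have e3 := mul_genFun_zero h3
  have e4 := mul_genFun_zero h4
  have hX : (1 - X : PowerSeries ℤ) ≠ 0 := fun h => by
    simpa using congrArg (coeff 0) h
  refine mul_left_cancel₀ hX ?_
  linear_combination e4 - (1 - X) * e3 + X ^ 2 * e1

theorem ncard_validSet_relation (n : ℕ) :
    ((validSet 4 (n + 2) 0 (n + 3)).ncard : ℤ) - (validSet 3 (n + 2) 0 (n + 3)).ncard =
      3 * ((validSet 4 (n + 1) 0 (n + 2)).ncard - (validSet 3 (n + 1) 0 (n + 2)).ncard) +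
      ((validSet 3 n 0 (n + 1)).ncard - (validSet 1 n 0 (n + 1)).ncard) := by
  have h := congrArg (coeff (n + 2)) genFun_relation
  have h3 : (3 * X : PowerSeries ℤ) = C 3 * X := by simp
  rw [h3, map_add, mul_assoc, coeff_C_mul, show n + 2 = (n + 1) + 1 from rfl, coeff_succ_X_mul,
    show n + 1 + 1 = n + 2 from rfl, coeff_X_pow_mul] at h
  simpa [genFun] using h


/-! ### The semiorder of a staircase function -/

/-- The partial order on `Fin n` in which `i < j` iff `i < g j`, where `g i ≤ i`. -/
abbrev stairOrder (n : ℕ) (g : ℕ → ℕ) (hg : ∀ i, g i ≤ i) :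
    PartialOrder (Fin n) where
  le i j := i = j ∨ (i : ℕ) < g j
  lt i j := (i : ℕ) < g j
  le_refl i := Or.inl rfl
  le_trans i j k := by
    rintro (rfl | h1) (rfl | h2)
    · exact Or.inl rfl
    · exact Or.inr h2
    · exact Or.inr h1
    · exact Or.inr ((h1.trans_le (hg j)).trans h2)
  lt_iff_le_not_ge i j := by
    have h1 := hg i
    have h2 := hg j
    constructor
    · intro h
      refine ⟨Or.inr h, ?_⟩
      rintro (rfl | h') <;> omega
    · rintro ⟨rfl | h, h'⟩
      · exact absurd (Or.inl rfl) h'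
      · exact h
  le_antisymm i j := by
    have hi := hg i
    have hj := hg j
    rintro (rfl | h1) (h | h2)
    · rfl
    · rfl
    · exact h.symm
    · omega

theorem isSemiorder_stairOrder (n : ℕ) {g : ℕ → ℕ} (hm : Monotone g) (hg : ∀ i, g i ≤ i) :
    @IsSemiorder (Fin n) (stairOrder n g hg) := by
  constructor
  · rintro ⟨x, y, z, w, hyx, hwz, -, hxw, hyz, -⟩
    change (y : ℕ) < g x at hyx
    change (w : ℕ) < g z at hwz
    rcases le_total (g x) (g z) with h | h
    · exact hyz.1 (Or.inr (hyx.trans_le h))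
    · exact hxw.2 (Or.inr (hwz.trans_le h))
  · rintro ⟨x, y, z, w, hzy, hyx, hxw, -, hzw⟩
    change (z : ℕ) < g y at hzy
    change (y : ℕ) < g x at hyx
    have h1 : g x ≤ w := not_lt.1 fun h => hxw.2 (Or.inr h)
    exact hzw.1 (Or.inr (hzy.trans_le (hm (by omega))))

/-- A chain with `k` elements below `m`, for the relation `i < g j`. -/
def ChainBelow (g : ℕ → ℕ) (k m : ℕ) : Prop :=
  ∃ c : Fin k → ℕ, (∀ j, c j < m) ∧ ∀ i j, i < j → c i < g (c j)

theorem hasChain_stairOrder (n : ℕ) {g : ℕ → ℕ} (hg : ∀ i, g i ≤ i) (k : ℕ) :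
    @HasChain (Fin n) (stairOrder n g hg).toPreorder k ↔ ChainBelow g k n := by
  constructor
  · rintro ⟨c, hc⟩
    exact ⟨fun j => c j, fun j => (c j).2, fun i j hij => hc hij⟩
  · rintro ⟨c, hc, hc'⟩
    exact ⟨fun j => ⟨c j, hc j⟩, fun i j hij => hc' i j hij⟩

theorem chainBelow_one {g : ℕ → ℕ} {m : ℕ} : ChainBelow g 1 m ↔ m ≠ 0 := by
  constructor
  · rintro ⟨c, hc, -⟩ rfl
    exact absurd (hc 0) (Nat.not_lt_zero _)
  · exact fun h => ⟨fun _ => 0, fun _ => Nat.pos_of_ne_zero h, fun i j hij => by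
      rw [Subsingleton.elim i j] at hij; exact absurd hij (lt_irrefl _)⟩

theorem not_chainBelow_succ_zero {g : ℕ → ℕ} {k : ℕ} : ¬ ChainBelow g (k + 1) 0 := by
  rintro ⟨c, hc, -⟩
  exact absurd (hc 0) (Nat.not_lt_zero _)

theorem chainBelow_succ {g : ℕ → ℕ} (hm : Monotone g) (hg : ∀ i, g i ≤ i) {k m : ℕ} :
    ChainBelow g (k + 1) (m + 1) ↔ ChainBelow g k (g m) := by
  constructor
  · rintro ⟨c, hc, hc'⟩
    exact ⟨fun j => c j.castSucc,
      fun j => (hc' _ _ (Fin.castSucc_lt_last j)).trans_le (hm (Nat.le_of_lt_succ (hc _))),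
      fun i j hij => hc' _ _ (by simpa using hij)⟩
  · rintro ⟨c, hc, hc'⟩
    refine ⟨Fin.snoc (α := fun _ => ℕ) c m, fun j => ?_, fun i j hij => ?_⟩
    · refine Fin.lastCases ?_ (fun j => ?_) j
      · simp
      · have := hc j
        have := hg m
        simp; omega
    · induction i using Fin.lastCases with
      | last => exact absurd hij (not_lt.2 (Fin.le_last j))
      | cast i =>
        induction j using Fin.lastCases with
        | last => simpa using hc i
        | cast j => simpa using hc' i j (by simpa using hij)

theorem chainBelow_congr {f g : ℕ → ℕ} {k m : ℕ} (h : ∀ i < m, f i = g i) :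
    ChainBelow f k m ↔ ChainBelow g k m := by
  constructor
  · rintro ⟨c, hc, hc'⟩
    exact ⟨c, hc, fun i j hij => h _ (hc j) ▸ hc' i j hij⟩
  · rintro ⟨c, hc, hc'⟩
    exact ⟨c, hc, fun i j hij => (h _ (hc j)).symm ▸ hc' i j hij⟩

/-! ### Lists as staircase functions -/

/-- The function reading a list from its end, constant after its length. -/
def stair : List ℕ → ℕ → ℕ
  | [], _ => 0
  | x :: l, i => if i < l.length then stair l i else x

theorem stair_le_headD {l : List ℕ} (hl : Valid l) (i : ℕ) : stair l i ≤ l.headD 0 := by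
  induction l with
  | nil => simp [stair]
  | cons x l ih =>
    have := ih hl.2.2
    have := hl.2.1
    simp only [stair, List.headD_cons]
    split_ifs <;> omega

theorem stair_monotone {l : List ℕ} (hl : Valid l) : Monotone (stair l) := by
  induction l with
  | nil => exact monotone_const
  | cons x l ih =>
    intro i j hij
    have h1 := ih hl.2.2 hij
    have h2 := stair_le_headD hl.2.2 i
    have := hl.2.1
    simp only [stair]
    split_ifs <;> omega

theorem stair_le {l : List ℕ} (hl : Valid l) (i : ℕ) : stair l i ≤ i := by
  induction l with
  | nil => simp [stair]
  | cons x l ih =>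
    have h1 := ih hl.2.2
    have := hl.1
    simp only [stair]
    split_ifs <;> omega

theorem Valid.drop {l : List ℕ} (hl : Valid l) (r : ℕ) : Valid (l.drop r) := by
  induction l generalizing r with
  | nil => simpa using hl
  | cons x l ih =>
    cases r with
    | zero => exact hl
    | succ r => exact ih hl.2.2 r

theorem stair_drop (l : List ℕ) (r : ℕ) {i : ℕ} (hi : i + r < l.length) :
    stair (l.drop r) i = stair l i := by
  induction l generalizing r with
  | nil => simp at hi
  | cons x l ih =>
    cases r with
    | zero => rfl
    | succ r =>
      simp only [List.length_cons] at hi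
      rw [List.drop_succ_cons, ih r (by omega), stair, if_pos (by omega)]

theorem short_iff {k : ℕ} {l : List ℕ} (hl : Valid l) :
    Short k l ↔ ¬ ChainBelow (stair l) (k + 1) l.length := by
  induction k generalizing l with
  | zero => simp [Short, chainBelow_one]
  | succ k ih =>
    cases l with
    | nil => simp [Short, not_chainBelow_succ_zero]
    | cons x l =>
      have hx := hl.1
      rw [Short, ih (hl.2.2.drop _), List.length_cons,
        chainBelow_succ (stair_monotone hl) (stair_le hl), List.length_drop]
      have : stair (x :: l) l.length = x := by simp [stair]
      rw [this, Nat.sub_sub_self hx]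
      refine not_congr (chainBelow_congr fun i hi => ?_)
      rw [stair_drop l _ (by omega), stair, if_pos (by omega)]

theorem eq_of_stair_eq {l m : List ℕ} (hlen : l.length = m.length)
    (h : ∀ i < l.length, stair l i = stair m i) : l = m := by
  induction l generalizing m with
  | nil => simpa using hlen.symm
  | cons x l ih =>
    cases m with
    | nil => simp at hlen
    | cons y m =>
      simp only [List.length_cons, add_left_inj] at hlen h
      have h1 := h l.length (by omega)
      simp only [stair, lt_irrefl, if_false, hlen] at h1
      subst h1
      rw [ih hlen fun i hi => ?_]
      have h2 := h i (by omega)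
      simpa [stair, hi, hlen ▸ hi] using h2

theorem exists_stair_eq {n : ℕ} (g : ℕ → ℕ) (hm : ∀ i j, i ≤ j → j < n → g i ≤ g j)
    (hg : ∀ i < n, g i ≤ i) : ∃ l, Valid l ∧ l.length = n ∧ ∀ i < n, stair l i = g i := by
  suffices ∃ l, Valid l ∧ l.length = n ∧ (∀ i < n, stair l i = g i) ∧
      ∀ i, i + 1 = n → l.headD 0 = g i by
    obtain ⟨l, h1, h2, h3, -⟩ := this
    exact ⟨l, h1, h2, h3⟩
  induction n with
  | zero => exact ⟨[], trivial, rfl, by simp, by simp⟩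
  | succ n ih =>
    obtain ⟨l, h1, h2, h3, h4⟩ := ih (fun i j hij hj => hm i j hij (by omega))
      (fun i hi => hg i (by omega))
    refine ⟨g n :: l, ⟨by simpa [h2] using hg n (by omega), ?_, h1⟩, by simp [h2], ?_, ?_⟩
    · rcases n with _ | n
      · simp [List.length_eq_zero_iff.1 h2]
      · rw [h4 n rfl]
        exact hm n (n + 1) (by omega) (by omega)
    · intro i hi
      simp only [stair, h2]
      split_ifs with h
      · exact h3 i h
      · rw [show i = n by omega]
    · intro i hi
      rw [show i = n by omega]; rfl

/-! ### Every semiorder comes from a staircase function -/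

theorem mem_iff_lt_card_of_lower {n : ℕ} (s : Finset (Fin n))
    (hs : ∀ i j, i ≤ j → j ∈ s → i ∈ s) (i : Fin n) : i ∈ s ↔ (i : ℕ) < s.card := by
  constructor
  · intro hi
    have := Finset.card_le_card (s := Finset.Iic i) (t := s) fun j hj =>
      hs j i (Finset.mem_Iic.1 hj) hi
    rw [Fin.card_Iic] at this
    omega
  · intro hi
    by_contra h
    have := Finset.card_le_card (s := s) (t := Finset.Iio i) fun j hj =>
      Finset.mem_Iio.2 (lt_of_not_ge fun hij => h (hs i j hij hj))
    rw [Fin.card_Iio] at this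
    omega

section

variable {α : Type*} [PartialOrder α]

theorem IsSemiorder.lt_or_lt (h : IsSemiorder α) {x y a b : α} (ha : x < a) (hb : y < b) :
    y < a ∨ x < b := by
  by_contra! hc
  obtain ⟨h1, h2⟩ := hc
  refine h.1 ⟨a, x, b, y, ha, hb, ?_, ?_, ?_, ?_⟩ <;> constructor <;> intro h3
  · exact h2 (ha.trans_le h3)
  · exact h1 (hb.trans_le h3)
  · exact h2 ((ha.trans_le h3).trans hb)
  · rcases h3.lt_or_eq with h3 | rfl
    · exact h1 h3
    · exact h2 (ha.trans hb)
  · rcases h3.lt_or_eq with h3 | rfl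
    · exact h2 h3
    · exact h1 (hb.trans ha)
  · exact h1 ((hb.trans_le h3).trans ha)
  · exact h2 (h3.trans_lt hb)
  · exact h1 (h3.trans_lt ha)

theorem IsSemiorder.lt_or_lt_of_lt (h : IsSemiorder α) {x y z : α} (w : α) (hzy : z < y)
    (hyx : y < x) : z < w ∨ w < x := by
  by_contra! hc
  obtain ⟨h1, h2⟩ := hc
  refine h.2 ⟨x, y, z, w, hzy, hyx, ?_, ?_, ?_⟩ <;> constructor <;> intro h3
  · exact h1 ((hzy.trans hyx).trans_le h3)
  · rcases h3.lt_or_eq with h3 | rfl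
    · exact h2 h3
    · exact h1 (hzy.trans hyx)
  · exact h1 (hzy.trans_le h3)
  · exact h2 (h3.trans_lt hyx)
  · rcases h3.lt_or_eq with h3 | rfl
    · exact h1 h3
    · exact h2 (hzy.trans hyx)
  · exact h2 (h3.trans_lt (hzy.trans hyx))

open Classical in
theorem IsSemiorder.exists_stair [Fintype α] (h : IsSemiorder α) {n : ℕ} (e₀ : Fin n ≃ α) :
    ∃ (e : Fin n ≃ α) (g : Fin n → ℕ), Monotone g ∧ (∀ i, g i ≤ i) ∧
      ∀ i j, e i < e j ↔ (i : ℕ) < g j := by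
  let D : α → Finset α := fun x => Finset.univ.filter (· < x)
  let U : α → Finset α := fun x => Finset.univ.filter (x < ·)
  let key : α → ℤ := fun x => (D x).card - (U x).card
  have exists_of_card_lt : ∀ {s t : Finset α}, s.card < t.card → ∃ a ∈ t, a ∉ s :=
    fun hst => Finset.exists_mem_notMem_of_card_lt_card hst
  have lower : ∀ z y x, key z ≤ key y → y < x → z < x := by
    intro z y x hk hyx
    by_contra hzx
    have hU : (U z).card < (U y).card := by
      refine Finset.card_lt_card ((Finset.ssubset_iff_of_subset fun a ha => ?_).2
        ⟨x, by simpa [U] using hyx, by simpa [U] using hzx⟩)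
      simp only [U, Finset.mem_filter, Finset.mem_univ, true_and] at ha ⊢
      exact (h.lt_or_lt ha hyx).resolve_right hzx
    obtain ⟨w, hw, hw'⟩ := exists_of_card_lt (s := D z) (t := D y) (by simp only [key] at hk; omega)
    simp only [D, Finset.mem_filter, Finset.mem_univ, true_and] at hw hw'
    exact (h.lt_or_lt_of_lt z hw hyx).elim hw' hzx
  have mono : ∀ z y, key z ≤ key y → (D z).card ≤ (D y).card := by
    intro z y hk
    by_contra! hD
    obtain ⟨a, ha, ha'⟩ := exists_of_card_lt hD
    obtain ⟨b, hb, hb'⟩ := exists_of_card_lt (s := U y) (t := U z)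
      (by simp only [key] at hk; omega)
    simp only [D, U, Finset.mem_filter, Finset.mem_univ, true_and] at ha ha' hb hb'
    exact (h.lt_or_lt_of_lt y ha hb).elim ha' hb'
  let e : Fin n ≃ α := (Tuple.sort (key ∘ e₀)).trans e₀
  have he : Monotone (key ∘ e) := Tuple.monotone_sort (key ∘ e₀)
  have card_eq : ∀ j, (Finset.univ.filter fun i => e i < e j).card = (D (e j)).card := fun j =>
    Finset.card_bij (fun i _ => e i) (by simp [D]) (by simp) fun a ha => by
      refine ⟨e.symm a, ?_, by simp⟩
      simpa [D] using ha
  have mem : ∀ i j, e i < e j ↔ (i : ℕ) < (D (e j)).card := by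
    intro i j
    rw [← card_eq, ← mem_iff_lt_card_of_lower]
    · simp
    · intro a b hab hb
      simp only [Finset.mem_filter, Finset.mem_univ, true_and] at hb ⊢
      exact lower _ _ _ (he hab) hb
  refine ⟨e, fun j => (D (e j)).card, fun i j hij => mono _ _ (he hij), fun i => ?_, mem⟩
  exact not_lt.1 fun hi => lt_irrefl _ ((mem i i).2 hi)

end

/-! ### Counting semiorders by lists -/

/-- The valid lists of length `n` with exactly `H + 1` blocks. -/
def blockSet (n H : ℕ) : Set (List ℕ) :=
  {l | Valid l ∧ l.length = n ∧ Short (H + 1) l ∧ ¬ Short H l}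

theorem hasLength_stairOrder {l : List ℕ} (hl : Valid l) (H : ℕ) :
    @HasLength (Fin l.length)
        (stairOrder l.length (stair l) (stair_le hl)).toPreorder H ↔
      Short (H + 1) l ∧ ¬ Short H l := by
  rw [HasLength, hasChain_stairOrder, hasChain_stairOrder, short_iff hl, short_iff hl, not_not,
    and_comm]

theorem HasChain.of_orderIso {α β : Type*} [Preorder α] [Preorder β] (e : α ≃o β) {k : ℕ}
    (h : HasChain α k) : HasChain β k :=
  h.imp' (fun c => e ∘ c) fun _ hc => e.strictMono.comp hc

theorem HasLength.of_orderIso {α β : Type*} [Preorder α] [Preorder β] (e : α ≃o β) {H : ℕ}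
    (h : HasLength α H) : HasLength β H :=
  ⟨h.1.of_orderIso e, fun h' => h.2 (h'.of_orderIso e.symm)⟩

open Classical in
/-- The multiset of the sizes of the strict down-sets of a partial order on `Fin n`. -/
noncomputable def downSizes {n : ℕ} (P : PartialOrder (Fin n)) : Multiset ℕ :=
  Finset.univ.val.map fun x => (Finset.univ.filter fun y => P.lt y x).card

theorem downSizes_eq_of_equiv {n : ℕ} {P Q : PartialOrder (Fin n)} (e : Fin n ≃ Fin n)
    (he : ∀ a b, P.le a b ↔ Q.le (e a) (e b)) : downSizes P = downSizes Q := by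
  classical
  have hlt : ∀ a b, P.lt a b ↔ Q.lt (e a) (e b) := fun a b => by
    rw [P.lt_iff_le_not_ge, Q.lt_iff_le_not_ge, he, he]
  have hcard : ∀ x, (Finset.univ.filter fun y => P.lt y x).card =
      (Finset.univ.filter fun y => Q.lt y (e x)).card := fun x =>
    Finset.card_bij (fun y _ => e y) (by simp [hlt]) (by simp) fun b hb =>
      ⟨e.symm b, by simpa [hlt] using hb, by simp⟩
  have huniv : (Finset.univ : Finset (Fin n)).val =
      (Finset.univ : Finset (Fin n)).val.map e := by
    rw [← Finset.map_univ_equiv e]; simp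
  rw [downSizes, downSizes, Multiset.map_congr rfl fun x _ => hcard x]
  conv_rhs => rw [huniv, Multiset.map_map]
  rfl

theorem downSizes_stairOrder (n : ℕ) {g : ℕ → ℕ} (hg : ∀ i, g i ≤ i) :
    downSizes (stairOrder n g hg) = (List.ofFn fun i : Fin n => g i : List ℕ) := by
  have hfun : (fun x : Fin n => g x) = fun x : Fin n =>
      (Finset.univ.filter fun y : Fin n => (y : ℕ) < g x).card := by
    funext x
    rw [Fin.card_filter_val_lt, min_eq_right ((hg x).trans x.2.le)]
  rw [hfun, List.ofFn_eq_map, downSizes]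
  simp only [Fin.univ_val_map, List.ofFn_eq_map]
  congr!

theorem eq_of_ofFn_perm {n : ℕ} {f g : Fin n → ℕ} (hf : Monotone f) (hg : Monotone g)
    (h : (List.ofFn f).Perm (List.ofFn g)) : f = g :=
  List.ofFn_injective (h.eq_of_sortedLE hf.sortedLE_ofFn hg.sortedLE_ofFn)

theorem fEx_eq_ncard_blockSet (H n : ℕ) : fEx H n = (blockSet n H).ncard := by
  have hpred : ∀ l : blockSet n H, SemiLen n H
      (stairOrder n (stair l) (stair_le l.2.1)) := by
    rintro ⟨l, hl, rfl, hs⟩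
    exact ⟨isSemiorder_stairOrder _ (stair_monotone hl) (stair_le hl),
      (hasLength_stairOrder hl H).2 hs⟩
  rw [fEx, countPosets, ← Nat.card_coe_set_eq]
  refine (Nat.card_congr (Equiv.ofBijective (fun l => Quot.mk _ ⟨_, hpred l⟩) ⟨?_, ?_⟩)).symm
  · intro l m hlm
    have h1 := congrArg (Quot.lift (fun P => downSizes P.1)
      fun P Q ⟨e, he⟩ => downSizes_eq_of_equiv e he) hlm
    change downSizes _ = downSizes _ at h1
    rw [downSizes_stairOrder n (stair_le l.2.1), downSizes_stairOrder n (stair_le m.2.1),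
      Multiset.coe_eq_coe] at h1
    have h2 := eq_of_ofFn_perm (fun i j hij => stair_monotone l.2.1 hij)
      (fun i j hij => stair_monotone m.2.1 hij) h1
    exact Subtype.ext (eq_of_stair_eq (l.2.2.1.trans m.2.2.1.symm) fun i hi =>
      congrFun h2 ⟨i, l.2.2.1 ▸ hi⟩)
  · intro q
    induction q using Quot.ind with
    | mk P =>
    obtain ⟨P, hP, hH⟩ := P
    obtain ⟨e, g, hm, hg, he⟩ := @IsSemiorder.exists_stair (Fin n) P _ hP n (Equiv.refl _)
    obtain ⟨l, hl, hlen, hlg⟩ := exists_stair_eq (n := n)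
      (fun i => if hi : i < n then g ⟨i, hi⟩ else 0)
      (fun i j hij hj => by
        simp only [hj, hij.trans_lt hj, dif_pos]
        exact hm hij)
      (fun i hi => by simpa [hi] using hg ⟨i, hi⟩)
    have hlt : ∀ i j : Fin n, P.lt (e i) (e j) ↔ (i : ℕ) < stair l j := fun i j => by
      rw [hlg j j.2]
      simpa using he i j
    have hle : ∀ i j : Fin n,
        (stairOrder n (stair l) (stair_le hl)).le i j ↔
          P.le (e i) (e j) := fun i j => by
      rw [@le_iff_lt_or_eq _ P, e.injective.eq_iff]
      exact (or_congr Iff.rfl (hlt i j).symm).trans or_comm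
    subst hlen
    have hH' := @HasLength.of_orderIso _ _ P.toPreorder
      (stairOrder _ (stair l) (stair_le hl)).toPreorder
      (@RelIso.symm _ _ _ _ ⟨e, fun {a b} => (hle a b).symm⟩) H hH
    exact ⟨⟨l, hl, rfl, (hasLength_stairOrder hl H).1 hH'⟩, Quot.sound ⟨e, hle⟩⟩

theorem mem_validSet_zero {k n : ℕ} {l : List ℕ} :
    l ∈ validSet k n 0 (n + 1) ↔ Valid l ∧ l.length = n ∧ Short k l := by
  simp only [validSet, Set.mem_ofPred_eq, add_zero, List.drop_zero]
  refine ⟨fun h => ⟨h.1, h.2.1, h.2.2.2⟩, fun h => ⟨h.1, h.2.1, ?_, h.2.2⟩⟩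
  obtain ⟨hl, rfl, -⟩ := h
  cases l with
  | nil => simp
  | cons x l =>
    have := hl.1
    simp; omega

theorem fEx_add_ncard (H n : ℕ) :
    fEx H n + (validSet H n 0 (n + 1)).ncard = (validSet (H + 1) n 0 (n + 1)).ncard := by
  have : blockSet n H = validSet (H + 1) n 0 (n + 1) \ validSet H n 0 (n + 1) := by
    ext l
    rw [Set.mem_sdiff, mem_validSet_zero, mem_validSet_zero]
    simp only [blockSet, Set.mem_ofPred_eq]
    tauto
  rw [fEx_eq_ncard_blockSet, this]
  refine Set.ncard_sdiff_add_ncard_of_subset (fun l hl => ?_) (finite_validSet _ _ _ _)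
  rw [mem_validSet_zero] at hl ⊢
  exact ⟨hl.1, hl.2.1, hl.2.2.succ⟩

theorem statement12 (n : ℕ) (hn : 2 ≤ n) :
    fEx 3 n = 3 * fEx 3 (n - 1) + fEx 2 (n - 2) + fEx 1 (n - 2) := by
  obtain ⟨n, rfl⟩ := Nat.exists_eq_add_of_le' hn
  have h := ncard_validSet_relation n
  have h1 := fEx_add_ncard 3 (n + 2)
  have h2 := fEx_add_ncard 3 (n + 1)
  have h3 := fEx_add_ncard 2 n
  have h4 := fEx_add_ncard 1 n
  simp only [add_assoc, Nat.reduceAdd] at h1 h2 h3 h4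
  simp only [Nat.add_sub_cancel, show n + 2 - 1 = n + 1 from rfl]
  omega

end Paper
end

section
/- The sequence f_{≤2}^n of numbers of nonisomorphic n-element semiorders of length at most two satisfies the recurrence f_{≤2}^n = 3·f_{≤2}^{n−1} − f_{≤2}^{n−2} for n ≥ 2. -/
namespace Paper

open Finset.HasAntidiagonal (antidiagonal)

/-- Monotone sequences starting at `0` that are constantly `q` from index `p` on. -/
def stepSeqs (p q : ℕ) : Set (ℕ → ℕ) := {s | Monotone s ∧ s 0 = 0 ∧ ∀ i, p ≤ i → s i = q}

theorem stepSeqs_zero_succ (q : ℕ) : stepSeqs 0 (q + 1) = ∅ := by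
  ext s
  simp only [stepSeqs, Set.mem_ofPred_eq, Set.mem_empty_iff_false, iff_false]
  rintro ⟨-, h0, h⟩
  have := h 0 le_rfl
  omega

theorem stepSeqs_zero_right (p : ℕ) : stepSeqs p 0 = {fun _ => 0} := by
  ext s
  simp only [stepSeqs, Set.mem_ofPred_eq, Set.mem_singleton_iff]
  constructor
  · rintro ⟨hm, -, h⟩
    funext i
    have h1 := hm (le_max_left i p)
    have h2 := h _ (le_max_right i p)
    omega
  · rintro rfl
    exact ⟨monotone_const, rfl, fun _ _ => rfl⟩

theorem stepSeqs_succ_succ (p q : ℕ) :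
    stepSeqs (p + 1) (q + 1) = stepSeqs p (q + 1) ∪
      (fun s i => if i ≤ p then s i else q + 1) '' stepSeqs (p + 1) q := by
  ext s
  simp only [stepSeqs, Set.mem_ofPred_eq, Set.mem_union, Set.mem_image]
  constructor
  · rintro ⟨hm, h0, h⟩
    by_cases hp : s p = q + 1
    · refine Or.inl ⟨hm, h0, fun i hi => ?_⟩
      rcases hi.eq_or_lt with rfl | hi
      · exact hp
      · exact h i hi
    · have hq : ∀ i, i ≤ p → s i ≤ q := fun i hi => by
        have h1 := hm hi
        have h2 := hm (Nat.le_succ p)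
        have h3 := h (p + 1) le_rfl
        simp only [Nat.succ_eq_add_one] at h2
        omega
      refine Or.inr ⟨fun i => min (s i) q, ⟨fun i j hij => min_le_min_right q (hm hij), ?_, ?_⟩, ?_⟩
      · simp [h0]
      · intro i hi
        simp [h i hi]
      · funext i
        dsimp only
        split_ifs with hi
        · exact min_eq_left (hq i hi)
        · exact (h i (by omega)).symm
  · rintro (⟨hm, h0, h⟩ | ⟨t, ⟨hm, h0, h⟩, rfl⟩)
    · exact ⟨hm, h0, fun i hi => h i (by omega)⟩
    · refine ⟨fun i j hij => ?_, by simp [h0], fun i hi => ?_⟩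
      · have h1 := hm hij
        have h2 := hm (le_max_left i (p + 1))
        have h3 := h _ (le_max_right i (p + 1))
        dsimp only
        split_ifs <;> omega
      · simp only [ite_eq_right_iff]
        omega

theorem encard_stepSeqs (p q : ℕ) : (stepSeqs p q).encard = (Nat.multichoose p q : ℕ∞) := by
  induction p generalizing q with
  | zero =>
    cases q with
    | zero => simp [stepSeqs_zero_right]
    | succ q => simp [stepSeqs_zero_succ]
  | succ p ihp =>
    induction q with
    | zero => simp [stepSeqs_zero_right]
    | succ q ihq =>
      rw [stepSeqs_succ_succ, Set.encard_union_eq, Set.InjOn.encard_image, ihp, ihq,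
        Nat.multichoose_succ_succ]
      · push_cast
        rfl
      · rintro s ⟨-, -, hs⟩ t ⟨-, -, ht⟩ hst
        funext i
        have := congrFun hst i
        dsimp only at this
        split_ifs at this with hi
        · exact this
        · rw [hs i (by omega), ht i (by omega)]
      · rw [Set.disjoint_left]
        rintro _ ⟨-, -, h⟩ ⟨t, ⟨hm, -, ht⟩, rfl⟩
        have h1 := h p le_rfl
        have h2 := hm (Nat.le_succ p)
        have h3 := ht (p + 1) le_rfl
        simp only [le_refl, if_true, Nat.succ_eq_add_one] at h1 h2
        omega

theorem finite_stepSeqs (p q : ℕ) : (stepSeqs p q).Finite :=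
  Set.finite_of_encard_eq_coe (encard_stepSeqs p q)

theorem card_stepSeqs (p q : ℕ) : (finite_stepSeqs p q).toFinset.card = Nat.multichoose p q := by
  have h := (finite_stepSeqs p q).encard_eq_coe_toFinset_card
  rw [encard_stepSeqs] at h
  exact_mod_cast h.symm

/-- Canonical forms of `n`-element semiorders of length at most two: `i < j` in the semiorder
when `g i ≤ j`. -/
def thresholds (n : ℕ) : Set (ℕ → ℕ) :=
  {g | Monotone g ∧ (∀ i, i < n → i < g i) ∧ (∀ i, n ≤ i → g i = n) ∧ g (g (g 0)) = n}

theorem thresholds_le {n : ℕ} {g : ℕ → ℕ} (hg : g ∈ thresholds n) (i : ℕ) : g i ≤ n :=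
  (hg.1 (le_max_left i n)).trans (hg.2.2.1 _ (le_max_right i n)).le

/-- The possible level sizes, together with the relations between consecutive levels. -/
noncomputable def levelData (n : ℕ) :
    Finset (Σ _ : ℕ × ℕ, Σ _ : ℕ × ℕ, (ℕ → ℕ) × (ℕ → ℕ)) :=
  (antidiagonal n).sigma fun x => (antidiagonal x.2).sigma fun y =>
    (finite_stepSeqs x.1 y.1).toFinset ×ˢ (finite_stepSeqs y.1 y.2).toFinset

theorem mem_levelData {n p m q r : ℕ} {s t : ℕ → ℕ} :
    (⟨(p, m), (q, r), s, t⟩ : Σ _ : ℕ × ℕ, Σ _ : ℕ × ℕ, (ℕ → ℕ) × (ℕ → ℕ)) ∈ levelData n ↔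
      p + m = n ∧ q + r = m ∧ s ∈ stepSeqs p q ∧ t ∈ stepSeqs q r := by
  simp [levelData]

/-- The threshold function with the given level data. -/
def glue (x : Σ _ : ℕ × ℕ, Σ _ : ℕ × ℕ, (ℕ → ℕ) × (ℕ → ℕ)) (i : ℕ) : ℕ :=
  if i < x.1.1 then x.1.1 + x.2.2.1 i else x.1.1 + x.2.1.1 + x.2.2.2 (i - x.1.1)

theorem glue_zero {n p m q r : ℕ} {s t : ℕ → ℕ} (h : ⟨(p, m), (q, r), s, t⟩ ∈ levelData n) :
    glue ⟨(p, m), (q, r), s, t⟩ 0 = p := by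
  obtain ⟨-, -, ⟨-, hs0, hs⟩, ⟨-, ht0, -⟩⟩ := mem_levelData.1 h
  have := hs p le_rfl
  simp only [glue, hs0, Nat.zero_sub, ht0]
  split_ifs with hp
  · rfl
  · obtain rfl : p = 0 := by omega
    omega

theorem glue_fst {n p m q r : ℕ} {s t : ℕ → ℕ} (h : ⟨(p, m), (q, r), s, t⟩ ∈ levelData n) :
    glue ⟨(p, m), (q, r), s, t⟩ p = p + q := by
  obtain ⟨-, -, -, ⟨-, ht0, -⟩⟩ := mem_levelData.1 h
  simp [glue, ht0]

theorem image_glue (n : ℕ) : glue '' (levelData n : Set _) = thresholds n := by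
  ext g
  constructor
  · rintro ⟨⟨⟨p, m⟩, ⟨q, r⟩, s, t⟩, h, rfl⟩
    have h0 := glue_zero h
    have h1 := glue_fst h
    obtain ⟨hm, hr, ⟨hsm, hs0, hs⟩, ⟨htm, ht0, ht⟩⟩ := mem_levelData.1 h
    have hsq : ∀ i, s i ≤ q := fun i =>
      (hsm (le_max_left i p)).trans (hs _ (le_max_right i p)).le
    refine ⟨fun i j hij => ?_, fun i hi => ?_, fun i hi => ?_, ?_⟩
    · have h2 := hsm hij
      have h3 := htm (Nat.sub_le_sub_right hij p)
      have h4 := hsq i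
      simp only [glue]
      split_ifs <;> omega
    · simp only [glue]
      split_ifs with hp
      · omega
      · by_cases hq : i < p + q
        · omega
        · rw [ht _ (by omega)]
          omega
    · simp only [glue]
      rw [if_neg (by omega), ht _ (by omega)]
      omega
    · rw [h0, h1]
      simp only [glue]
      rw [if_neg (by omega), ht _ (by omega)]
      omega
  · intro hg
    have hle := thresholds_le hg
    obtain ⟨hm, hlt, hn, h3⟩ := hg
    have hp : g 0 ≤ g (g 0) := hm (Nat.zero_le _)
    have hgp : ∀ i, g 0 ≤ g i := fun i => hm (Nat.zero_le _)
    have hq := hle (g 0)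
    refine ⟨⟨(g 0, n - g 0), (g (g 0) - g 0, n - g (g 0)), fun i => min (g i) (g (g 0)) - g 0,
      fun i => g (g 0 + i) - g (g 0)⟩, ?_, ?_⟩
    · rw [Finset.mem_coe, mem_levelData]
      refine ⟨by omega, by omega, ⟨fun i j hij => ?_, ?_, fun i hi => ?_⟩,
        ⟨fun i j hij => ?_, by simp, fun i hi => ?_⟩⟩
      · have := hm hij
        dsimp only
        omega
      · dsimp only
        omega
      · have := hm hi
        dsimp only
        omega
      · have := hm (Nat.add_le_add_left hij (g 0))
        dsimp only
        omega
      · have h4 : g (g 0) ≤ g 0 + i := by omega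
        have := hm h4
        have := hle (g 0 + i)
        dsimp only
        omega
    · funext i
      simp only [glue]
      split_ifs with hi
      · have := hm hi.le
        have := hgp i
        omega
      · have := hm (not_lt.1 hi)
        rw [show g 0 + (i - g 0) = i by omega]
        omega

theorem injOn_glue (n : ℕ) : Set.InjOn glue (levelData n : Set _) := by
  rintro ⟨⟨p, m⟩, ⟨q, r⟩, s, t⟩ h ⟨⟨p', m'⟩, ⟨q', r'⟩, s', t'⟩ h' heq
  obtain rfl : p = p' := by rw [← glue_zero h, heq, glue_zero h']
  obtain rfl : q = q' := by
    have h1 := glue_fst h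
    rw [heq, glue_fst h'] at h1
    omega
  obtain ⟨hm, hr, ⟨-, -, hs⟩, -⟩ := mem_levelData.1 h
  obtain ⟨hm', hr', ⟨-, -, hs'⟩, -⟩ := mem_levelData.1 h'
  obtain rfl : m = m' := by omega
  obtain rfl : r = r' := by omega
  obtain rfl : s = s' := by
    funext i
    by_cases hi : i < p
    · have := congrFun heq i
      simpa [glue, hi] using this
    · rw [hs i (by omega), hs' i (by omega)]
  obtain rfl : t = t' := by
    funext i
    have := congrFun heq (p + i)
    simpa [glue] using this
  rfl

/-- Number of ways to relate a first level of size `p` to `m` elements on later levels. -/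
def fiberSum (p m : ℕ) : ℕ :=
  ∑ y ∈ antidiagonal m, Nat.multichoose p y.1 * Nat.multichoose y.1 y.2

/-- The variant of `fiberSum` with the second level enlarged by one element. -/
def fiberSumSucc (p m : ℕ) : ℕ :=
  ∑ y ∈ antidiagonal m, Nat.multichoose p y.1 * Nat.multichoose (y.1 + 1) y.2

theorem ncard_thresholds (n : ℕ) :
    (thresholds n).ncard = ∑ x ∈ antidiagonal n, fiberSum x.1 x.2 := by
  rw [← image_glue, (injOn_glue n).ncard_image, Set.ncard_coe_finset]
  simp [levelData, Finset.card_sigma, card_stepSeqs, fiberSum]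

theorem fiberSum_zero_right (p : ℕ) : fiberSum p 0 = 1 := by simp [fiberSum]

theorem fiberSumSucc_zero_right (p : ℕ) : fiberSumSucc p 0 = 1 := by simp [fiberSumSucc]

theorem fiberSum_zero_succ (m : ℕ) : fiberSum 0 (m + 1) = 0 := by
  simp [fiberSum, Finset.Nat.sum_antidiagonal_succ]

theorem fiberSum_succ_succ (p m : ℕ) :
    fiberSum (p + 1) (m + 1) = fiberSum p (m + 1) + fiberSumSucc (p + 1) m := by
  simp only [fiberSum, fiberSumSucc, Finset.Nat.sum_antidiagonal_succ, Nat.multichoose_zero_succ,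
    Nat.multichoose_succ_succ p, add_mul, Finset.sum_add_distrib]
  ring

theorem fiberSumSucc_succ (p m : ℕ) :
    fiberSumSucc p (m + 1) = fiberSum p (m + 1) + fiberSumSucc p m := by
  simp only [fiberSum, fiberSumSucc, Finset.Nat.sum_antidiagonal_succ', Nat.multichoose_zero_right,
    Nat.multichoose_succ_succ, mul_add, Finset.sum_add_distrib]
  ring

theorem sum_fiberSum_succ (n : ℕ) :
    ∑ x ∈ antidiagonal (n + 1), fiberSum x.1 x.2 =
      ∑ x ∈ antidiagonal n, fiberSum (x.1 + 1) x.2 := by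
  simp [Finset.Nat.sum_antidiagonal_succ, fiberSum_zero_succ]

theorem sum_fiberSum_add_two (n : ℕ) :
    ∑ x ∈ antidiagonal (n + 2), fiberSum x.1 x.2 =
      ∑ x ∈ antidiagonal (n + 1), fiberSum x.1 x.2 +
        ∑ x ∈ antidiagonal n, fiberSumSucc (x.1 + 1) x.2 := by
  rw [sum_fiberSum_succ (n + 1)]
  simp only [Finset.Nat.sum_antidiagonal_succ' (n := n), fiberSum_zero_right, fiberSum_succ_succ,
    Finset.sum_add_distrib]
  ring

theorem sum_fiberSumSucc_succ (n : ℕ) :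
    ∑ x ∈ antidiagonal (n + 1), fiberSumSucc (x.1 + 1) x.2 =
      ∑ x ∈ antidiagonal (n + 2), fiberSum x.1 x.2 +
        ∑ x ∈ antidiagonal n, fiberSumSucc (x.1 + 1) x.2 := by
  rw [sum_fiberSum_succ (n + 1)]
  simp only [Finset.Nat.sum_antidiagonal_succ' (n := n), fiberSum_zero_right,
    fiberSumSucc_zero_right, fiberSumSucc_succ, Finset.sum_add_distrib]
  ring

theorem ncard_thresholds_add_two (n : ℕ) :
    (thresholds (n + 2)).ncard + (thresholds n).ncard = 3 * (thresholds (n + 1)).ncard := by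
  simp only [ncard_thresholds]
  cases n with
  | zero =>
    simp [sum_fiberSum_add_two, sum_fiberSum_succ, fiberSum_zero_right, fiberSumSucc_zero_right]
  | succ n =>
    have h1 := sum_fiberSum_add_two (n + 1)
    have h2 := sum_fiberSumSucc_succ n
    have h3 := sum_fiberSum_add_two n
    simp only [add_assoc, Nat.reduceAdd] at *
    omega

/-- The semiorder with threshold function `g`. -/
@[reducible]
def thresholdOrder {n : ℕ} {g : ℕ → ℕ} (hg : g ∈ thresholds n) : PartialOrder (Fin n) where
  le i j := i = j ∨ g i ≤ j
  lt i j := g i ≤ j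
  le_refl i := Or.inl rfl
  le_trans i j k := by
    rintro (rfl | h) (rfl | h')
    · exact Or.inl rfl
    · exact Or.inr h'
    · exact Or.inr h
    · have := hg.2.1 j j.2
      exact Or.inr (by omega)
  le_antisymm i j := by
    rintro (h | h) (h' | h')
    · exact h
    · exact h
    · exact h'.symm
    · have := hg.2.1 j j.2
      have := hg.2.1 i i.2
      omega
  lt_iff_le_not_ge i j := by
    have h1 := hg.2.1 j j.2
    have h2 := hg.2.1 i i.2
    constructor
    · refine fun h => ⟨Or.inr h, ?_⟩
      rintro (rfl | h') <;> omega
    · rintro ⟨rfl | h, h'⟩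
      · exact absurd (Or.inl rfl) h'
      · exact h

theorem semiLenLe_thresholdOrder {n : ℕ} {g : ℕ → ℕ} (hg : g ∈ thresholds n) :
    SemiLenLe n 2 (thresholdOrder hg) := by
  refine ⟨⟨?_, ?_⟩, ?_⟩
  · rintro ⟨x, y, z, w, hyx, hwz, -, ⟨-, hxw⟩, ⟨hyz, -⟩, -⟩
    replace hyx : g y ≤ x := hyx
    replace hwz : g w ≤ z := hwz
    rcases le_total (x : ℕ) z with h | h
    · exact hyz (Or.inr (hyx.trans h))
    · exact hxw (Or.inr (hwz.trans h))
  · rintro ⟨x, y, z, w, hzy, hyx, ⟨-, hwx⟩, -, ⟨hzw, -⟩⟩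
    replace hzy : g z ≤ y := hzy
    replace hyx : g y ≤ x := hyx
    have h : (w : ℕ) ≤ y := by
      by_contra h
      exact hzw (Or.inr (by omega))
    exact hwx (Or.inr ((hg.1 h).trans hyx))
  · rintro ⟨c, hc⟩
    have h1 : g (c 0) ≤ c 1 := hc (show (0 : Fin 4) < 1 by decide)
    have h2 : g (c 1) ≤ c 2 := hc (show (1 : Fin 4) < 2 by decide)
    have h3 : g (c 2) ≤ c 3 := hc (show (2 : Fin 4) < 3 by decide)
    have h4 := hg.1 (((hg.1 (((hg.1 (Nat.zero_le _)).trans h1))).trans h2))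
    have := hg.2.2.2
    have := (c 3).2
    omega

section Semiorder

variable {α : Type*} [PartialOrder α]

theorem IsSemiorder.lt_or_lt_s13 (h : IsSemiorder α) {x y z w : α} (hyx : y < x) (hwz : w < z) :
    y < z ∨ w < x := by
  by_contra! hc
  obtain ⟨h1, h2⟩ := hc
  refine h.1 ⟨x, y, z, w, hyx, hwz, ⟨fun hxz => h1 (hyx.trans_le hxz), fun hzx =>
    h2 (hwz.trans_le hzx)⟩, ⟨fun hxw => h1 (hyx.trans_le (hxw.trans hwz.le)), fun hwx => ?_⟩,
    ⟨fun hyz => ?_, fun hzy => h2 (hwz.trans_le (hzy.trans hyx.le))⟩,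
    ⟨fun hyw => h1 (hyw.trans_lt hwz), fun hwy => h2 (hwy.trans_lt hyx)⟩⟩
  · rcases hwx.lt_or_eq with hlt | rfl
    · exact h2 hlt
    · exact h1 (hyx.trans hwz)
  · rcases hyz.lt_or_eq with hlt | rfl
    · exact h1 hlt
    · exact h2 (hwz.trans hyx)

theorem IsSemiorder.lt_or_lt_of_chain (h : IsSemiorder α) {d y u : α} (hdy : d < y) (hyu : y < u)
    (x : α) : d < x ∨ x < u := by
  by_contra! hc
  obtain ⟨h1, h2⟩ := hc
  have hux : ¬ u ≤ x := fun hux => h1 ((hdy.trans hyu).trans_le hux)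
  have hxd : ¬ x ≤ d := fun hxd => h2 (hxd.trans_lt (hdy.trans hyu))
  refine h.2 ⟨u, y, d, x, hdy, hyu, ⟨hux, fun hxu => ?_⟩, ⟨fun hyx => h1 (hdy.trans_le hyx),
    fun hxy => h2 (hxy.trans_lt hyu)⟩, ⟨fun hdx => ?_, hxd⟩⟩
  · rcases hxu.lt_or_eq with hlt | rfl
    · exact h2 hlt
    · exact hux le_rfl
  · rcases hdx.lt_or_eq with hlt | rfl
    · exact h1 hlt
    · exact hxd le_rfl

open scoped Classical in
/-- Number of elements below minus number of elements above. -/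
noncomputable def rankKey [Fintype α] (x : α) : ℤ :=
  (Finset.univ.filter (· < x)).card - (Finset.univ.filter (x < ·)).card

open scoped Classical in
theorem IsSemiorder.of_rankKey_le [Fintype α] (h : IsSemiorder α) {x y : α}
    (hxy : rankKey x ≤ rankKey y) : (∀ d, d < x → d < y) ∧ ∀ u, y < u → x < u := by
  unfold rankKey at hxy
  have down : ∀ d, d < x → ¬ d < y → (Finset.univ.filter (· < y)).card <
      (Finset.univ.filter (· < x)).card := fun d hdx hdy =>
    Finset.card_lt_card ⟨fun e he => by
      simp only [Finset.mem_filter, Finset.mem_univ, true_and] at he ⊢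
      exact (h.lt_or_lt_s13 he hdx).resolve_right hdy,
      fun hs => hdy (by simpa using hs (show d ∈ _ by simpa using hdx))⟩
  have up : ∀ u, y < u → ¬ x < u → (Finset.univ.filter (x < ·)).card <
      (Finset.univ.filter (y < ·)).card := fun u hyu hxu =>
    Finset.card_lt_card ⟨fun e he => by
      simp only [Finset.mem_filter, Finset.mem_univ, true_and] at he ⊢
      exact (h.lt_or_lt_s13 he hyu).resolve_left hxu,
      fun hs => hxu (by simpa using hs (show u ∈ _ by simpa using hyu))⟩
  constructor
  · intro d hdx
    by_contra hdy
    have h1 := down d hdx hdy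
    have h2 : (Finset.univ.filter (x < ·)).card ≤ (Finset.univ.filter (y < ·)).card :=
      Finset.card_le_card fun u hu => by
        simp only [Finset.mem_filter, Finset.mem_univ, true_and] at hu ⊢
        exact (h.lt_or_lt_of_chain hdx hu y).resolve_left hdy
    omega
  · intro u hyu
    by_contra hxu
    have h1 := up u hyu hxu
    have h2 : (Finset.univ.filter (· < y)).card ≤ (Finset.univ.filter (· < x)).card :=
      Finset.card_le_card fun d hd => by
        simp only [Finset.mem_filter, Finset.mem_univ, true_and] at hd ⊢
        exact (h.lt_or_lt_of_chain hd hyu x).resolve_right hxu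
    omega

theorem IsSemiorder.exists_thresholds {n : ℕ} (σ₀ : Fin n ≃ α) (h : IsSemiorder α)
    (hc : ¬ HasChain α 4) :
    ∃ g ∈ thresholds n, ∃ σ : Fin n ≃ α, ∀ i j : Fin n, σ i < σ j ↔ g i ≤ j := by
  have : Fintype α := Fintype.ofEquiv _ σ₀
  obtain ⟨σ, hσ⟩ : ∃ σ : Fin n ≃ α, Monotone fun i => rankKey (σ i) :=
    ⟨(Tuple.sort fun i => rankKey (σ₀ i)).trans σ₀, Tuple.monotone_sort fun i => rankKey (σ₀ i)⟩
  have anti : ∀ {i i' j : Fin n}, i' ≤ i → σ i < σ j → σ i' < σ j := fun hi hij =>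
    (h.of_rankKey_le (hσ hi)).2 _ hij
  have mono : ∀ {i j j' : Fin n}, j ≤ j' → σ i < σ j → σ i < σ j' := fun hj hij =>
    (h.of_rankKey_le (hσ hj)).1 _ hij
  have lt : ∀ {i j : Fin n}, σ i < σ j → i < j := fun {i j} hij => by
    by_contra hji
    exact lt_irrefl _ (mono (not_lt.1 hji) hij)
  let A : ℕ → Set ℕ := fun i => {m | n ≤ m ∨ ∃ i' j : Fin n, i ≤ i' ∧ (j : ℕ) ≤ m ∧ σ i' < σ j}
  have hA : ∀ i, sInf (A i) ∈ A i := fun i => Nat.sInf_mem ⟨n, Or.inl le_rfl⟩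
  have key : ∀ i j : Fin n, σ i < σ j ↔ sInf (A i) ≤ j := fun i j => by
    constructor
    · exact fun hij => Nat.sInf_le (Or.inr ⟨i, j, le_rfl, le_rfl, hij⟩)
    · intro hij
      rcases hA i with hn | ⟨i', j', hi, hj, hlt⟩
      · omega
      · exact mono (hj.trans hij) (anti hi hlt)
  have hle : ∀ i, sInf (A i) ≤ n := fun i => Nat.sInf_le (Or.inl le_rfl)
  have hlast : ∀ i, n ≤ i → sInf (A i) = n := fun i hi => by
    refine le_antisymm (hle i) ?_
    rcases hA i with hn | ⟨i', -, hi', -⟩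
    · exact hn
    · omega
  have hlt : ∀ i, i < n → i < sInf (A i) := fun i hi => by
    rcases hA i with hn | ⟨i', j', hi', hj, h'⟩
    · omega
    · have := lt h'
      omega
  refine ⟨fun i => sInf (A i), ⟨fun i j hij => ?_, hlt, hlast, ?_⟩, σ, key⟩
  · rcases hA j with hn | ⟨i', j', hi, hj, h'⟩
    · exact Nat.sInf_le (Or.inl hn)
    · exact Nat.sInf_le (Or.inr ⟨i', j', hij.trans hi, hj, h'⟩)
  · dsimp only
    by_contra hne
    have h3 : sInf (A (sInf (A (sInf (A 0))))) < n := lt_of_le_of_ne (hle _) hne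
    have h2 : sInf (A (sInf (A 0))) < n := by
      by_contra hn
      exact hne (hlast _ (not_lt.1 hn))
    have h1 : sInf (A 0) < n := by
      by_contra hn
      exact h2.ne (hlast _ (not_lt.1 hn))
    refine hc ⟨![σ ⟨0, by omega⟩, σ ⟨_, h1⟩, σ ⟨_, h2⟩, σ ⟨_, h3⟩], Fin.strictMono_iff_lt_succ.2 ?_⟩
    intro i
    fin_cases i
    · exact (key _ _).2 le_rfl
    · exact (key _ _).2 le_rfl
    · exact (key _ _).2 le_rfl

end Semiorder

theorem thresholds_eq_of_equiv {n : ℕ} {g g' : ℕ → ℕ} (hg : g ∈ thresholds n)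
    (hg' : g' ∈ thresholds n) (e : Fin n ≃ Fin n)
    (he : ∀ i j : Fin n, (i = j ∨ g i ≤ j) ↔ (e i = e j ∨ g' (e i) ≤ e j)) : g = g' := by
  have hlt : ∀ i j : Fin n, g i ≤ j ↔ g' (e i) ≤ e j := fun i j => by
    by_cases hij : i = j
    · subst hij
      have := hg.2.1 i i.2
      have := hg'.2.1 (e i) (e i).2
      omega
    · simpa [hij] using he i j
  have hcard : ∀ {f : ℕ → ℕ}, f ∈ thresholds n → ∀ i : Fin n,
      (Finset.univ.filter fun j : Fin n => f i ≤ j).card = n - f i := fun {f} hf i => by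
    have h1 := Fin.card_filter_val_lt (n := n) (m := f i)
    have h2 := Finset.card_filter_add_card_filter_not (s := (Finset.univ : Finset (Fin n)))
      (fun j => (j : ℕ) < f i)
    have h3 := thresholds_le hf i
    simp only [not_lt, Finset.card_univ, Fintype.card_fin] at h2
    omega
  have heq : ∀ i : Fin n, g i = g' (e i) := fun i => by
    have h1 := hcard hg i
    have h2 := hcard hg' (e i)
    have h3 : (Finset.univ.filter fun j : Fin n => g i ≤ j).card =
        (Finset.univ.filter fun j : Fin n => g' (e i) ≤ j).card :=
      Finset.card_equiv e fun j => by simp [hlt i j]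
    have := thresholds_le hg i
    have := thresholds_le hg' (e i)
    omega
  have hm : Monotone ((fun i : Fin n => g' i) ∘ e) := fun i j hij => by
    simpa only [Function.comp, ← heq] using hg.1 hij
  have hm' : Monotone ((fun i : Fin n => g' i) ∘ Equiv.refl (Fin n)) := fun i j hij => hg'.1 hij
  have hfin := Tuple.unique_monotone hm hm'
  funext i
  by_cases hi : i < n
  · exact (heq ⟨i, hi⟩).trans (congrFun hfin ⟨i, hi⟩)
  · rw [hg.2.2.1 i (not_lt.1 hi), hg'.2.2.1 i (not_lt.1 hi)]

theorem fLe_two_eq_ncard_thresholds (n : ℕ) : fLe 2 n = (thresholds n).ncard := by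
  rw [← Nat.card_coe_set_eq]
  refine (Nat.card_congr (Equiv.ofBijective (fun g : thresholds n =>
    Quot.mk _ ⟨thresholdOrder g.2, semiLenLe_thresholdOrder g.2⟩) ⟨?_, ?_⟩)).symm
  · intro g g' h
    rw [Equivalence.quot_mk_eq_iff] at h
    · obtain ⟨e, he⟩ := h
      exact Subtype.ext (thresholds_eq_of_equiv g.2 g'.2 e he)
    · refine ⟨fun P => ⟨Equiv.refl _, fun _ _ => Iff.rfl⟩, ?_, ?_⟩
      · rintro P Q ⟨e, he⟩
        exact ⟨e.symm, fun a b => by simp [he]⟩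
      · rintro P Q R ⟨e, he⟩ ⟨e', he'⟩
        exact ⟨e.trans e', fun a b => (he a b).trans (he' _ _)⟩
  · rintro ⟨P, hP⟩
    obtain ⟨g, hg, σ, hσ⟩ := @IsSemiorder.exists_thresholds (Fin n) P n (Equiv.refl _) hP.1 hP.2
    refine ⟨⟨g, hg⟩, Quot.sound ⟨σ, fun i j => ?_⟩⟩
    rw [@le_iff_eq_or_lt _ P, hσ, σ.injective.eq_iff]
    rfl

theorem statement13 (n : ℕ) (hn : 2 ≤ n) :
    (fLe 2 n : ℤ) = 3 * (fLe 2 (n - 1) : ℤ) - (fLe 2 (n - 2) : ℤ) := by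
  obtain ⟨k, rfl⟩ := Nat.exists_eq_add_of_le' hn
  have h := ncard_thresholds_add_two k
  rw [← fLe_two_eq_ncard_thresholds, ← fLe_two_eq_ncard_thresholds,
    ← fLe_two_eq_ncard_thresholds] at h
  rw [show k + 2 - 1 = k + 1 by omega, show k + 2 - 2 = k by omega]
  omega

end Paper
end

section
/- For each m ≥ 1 and 1 ≤ k ≤ m, the number of distinct sets RtLM(σ) = {(a, σ(a)) : σ(a) is a right-to-left minimum of σ} over permutations σ of {1,...,m} having exactly k right-to-left minima equals the Narayana number N(m,k) = (1/m)·C(m,k)·C(m,k−1). -/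
namespace Paper

/-- `σ a` is a right-to-left minimum of `σ`. -/
def IsRtLMin {m : ℕ} (σ : Equiv.Perm (Fin m)) (a : Fin m) : Prop :=
  ∀ b, a < b → σ a < σ b

/-- The set of (position, value) pairs of right-to-left minima of `σ`. -/
def RtLM {m : ℕ} (σ : Equiv.Perm (Fin m)) : Set (Fin m × Fin m) :=
  {p | p.2 = σ p.1 ∧ IsRtLMin σ p.1}

/-- The number of right-to-left minima of `σ`. -/
noncomputable def numRtLMin {m : ℕ} (σ : Equiv.Perm (Fin m)) : ℕ :=
  Nat.card {a : Fin m // IsRtLMin σ a}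

section

open Finset

/-- `A` has `p` elements, `B` has `q` elements, and below each `t < m` the set `A` has fewer elements
than `B` has up to `t`. For `p = q` and sets of naturals below `m`, this says that
`A = {a₁ < ⋯ < aₖ}` and `B = {b₁ < ⋯ < bₖ}` satisfy `b₁ = 0`, `bᵢ₊₁ ≤ aᵢ + 1` and `aₖ = m - 1`. -/
def Interlaced (m p q : ℕ) (A B : Finset ℕ) : Prop :=
  #A = p ∧ #B = q ∧ ∀ t < m, #{a ∈ A | a < t} < #{b ∈ B | b ≤ t}

instance (m p q : ℕ) (A B : Finset ℕ) : Decidable (Interlaced m p q A B) := by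
  unfold Interlaced; infer_instance

/-- The number of pairs of subsets of `{0, …, m - 1}` that are `Interlaced m p q`. -/
def interlacedCount (m p q : ℕ) : ℕ :=
  ∑ A ∈ (range m).powerset, ∑ B ∈ (range m).powerset, if Interlaced m p q A B then 1 else 0

lemma filter_lt_insert_self {m t : ℕ} (A : Finset ℕ) (ht : t ≤ m) :
    {a ∈ insert m A | a < t} = {a ∈ A | a < t} := by
  rw [filter_insert, if_neg (by omega)]

lemma filter_le_insert_self {m t : ℕ} (B : Finset ℕ) (ht : t < m) :
    {b ∈ insert m B | b ≤ t} = {b ∈ B | b ≤ t} := by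
  rw [filter_insert, if_neg (by omega)]

section
variable {m p q : ℕ} {A B : Finset ℕ}

lemma filter_lt_eq_self (hA : A ⊆ range m) : {a ∈ A | a < m} = A :=
  filter_true_of_mem fun _ h ↦ mem_range.1 (hA h)

lemma filter_le_eq_self (hB : B ⊆ range (m + 1)) : {b ∈ B | b ≤ m} = B :=
  filter_true_of_mem fun _ h ↦ Nat.lt_succ_iff.1 (mem_range.1 (hB h))

lemma notMem_of_subset_range (hA : A ⊆ range m) : m ∉ A := fun h ↦ by simpa using hA h

lemma subset_range_succ (hA : A ⊆ range m) : A ⊆ range (m + 1) :=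
  hA.trans (range_subset_range.2 m.le_succ)

lemma insert_subset_range_succ (hA : A ⊆ range m) : insert m A ⊆ range (m + 1) := by
  rw [range_add_one]; exact insert_subset_insert _ hA

lemma interlaced_succ (hA : A ⊆ range m) (hB : B ⊆ range m) :
    Interlaced (m + 1) p q A B ↔ p < q ∧ Interlaced m p q A B := by
  simp only [Interlaced, Nat.forall_lt_succ_right, filter_lt_eq_self hA,
    filter_le_eq_self (subset_range_succ hB)]
  grind

lemma interlaced_succ_insert_left (hA : A ⊆ range m) (hB : B ⊆ range m) :
    Interlaced (m + 1) (p + 1) q (insert m A) B ↔ p < q ∧ Interlaced m p q A B := by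
  have h : ∀ t < m, #{a ∈ insert m A | a < t} = #{a ∈ A | a < t} :=
    fun t ht ↦ by rw [filter_lt_insert_self A ht.le]
  simp only [Interlaced, Nat.forall_lt_succ_right, filter_lt_insert_self A le_rfl, filter_lt_eq_self hA,
    filter_le_eq_self (subset_range_succ hB), card_insert_of_notMem (notMem_of_subset_range hA)]
  grind

lemma interlaced_succ_insert_right (hA : A ⊆ range m) (hB : B ⊆ range m) :
    Interlaced (m + 1) p (q + 1) A (insert m B) ↔ p < q + 1 ∧ Interlaced m p q A B := by
  have h : ∀ t < m, #{b ∈ insert m B | b ≤ t} = #{b ∈ B | b ≤ t} :=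
    fun t ht ↦ by rw [filter_le_insert_self B ht]
  simp only [Interlaced, Nat.forall_lt_succ_right, filter_lt_eq_self hA,
    filter_le_eq_self (insert_subset_range_succ hB),
    card_insert_of_notMem (notMem_of_subset_range hB)]
  grind

lemma interlaced_succ_insert_insert (hA : A ⊆ range m) (hB : B ⊆ range m) :
    Interlaced (m + 1) (p + 1) (q + 1) (insert m A) (insert m B) ↔
      p < q + 1 ∧ Interlaced m p q A B := by
  have h : ∀ t < m, #{a ∈ insert m A | a < t} = #{a ∈ A | a < t} :=
    fun t ht ↦ by rw [filter_lt_insert_self A ht.le]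
  have h' : ∀ t < m, #{b ∈ insert m B | b ≤ t} = #{b ∈ B | b ≤ t} :=
    fun t ht ↦ by rw [filter_le_insert_self B ht]
  simp only [Interlaced, Nat.forall_lt_succ_right, filter_lt_insert_self A le_rfl, filter_lt_eq_self hA,
    filter_le_eq_self (insert_subset_range_succ hB),
    card_insert_of_notMem (notMem_of_subset_range hA),
    card_insert_of_notMem (notMem_of_subset_range hB)]
  grind

lemma not_interlaced_insert_left : ¬ Interlaced m 0 q (insert p A) B := fun h ↦ by
  simpa using h.1

lemma not_interlaced_succ_zero_right : ¬ Interlaced (m + 1) p 0 A B := fun h ↦ by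
  have := h.2.2 0 m.succ_pos
  simp [card_eq_zero.1 h.2.1] at this

end

lemma interlacedCount_succ_zero_right (m p : ℕ) : interlacedCount (m + 1) p 0 = 0 := by
  simp [interlacedCount, not_interlaced_succ_zero_right]

lemma interlacedCount_succ (m p q : ℕ) :
    interlacedCount (m + 1) p q =
      ∑ A ∈ (range m).powerset, ∑ B ∈ (range m).powerset,
        ((if Interlaced (m + 1) p q A B then 1 else 0) +
          (if Interlaced (m + 1) p q A (insert m B) then 1 else 0) +
          ((if Interlaced (m + 1) p q (insert m A) B then 1 else 0) +
          (if Interlaced (m + 1) p q (insert m A) (insert m B) then 1 else 0))) := by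
  simp only [interlacedCount, range_add_one, sum_powerset_insert notMem_range_self,
    sum_add_distrib]

lemma interlacedCount_zero_succ (m q : ℕ) :
    interlacedCount (m + 1) 0 (q + 1) = interlacedCount m 0 (q + 1) + interlacedCount m 0 q := by
  rw [interlacedCount_succ, interlacedCount, interlacedCount, ← sum_add_distrib]
  refine sum_congr rfl fun A hA ↦ ?_
  rw [← sum_add_distrib]
  refine sum_congr rfl fun B hB ↦ ?_
  rw [mem_powerset] at hA hB
  simp [interlaced_succ hA hB, interlaced_succ_insert_right hA hB, not_interlaced_insert_left]

lemma interlacedCount_succ_succ {m p q : ℕ} (h : p < q) :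
    interlacedCount (m + 1) (p + 1) (q + 1) = interlacedCount m (p + 1) (q + 1) +
      interlacedCount m (p + 1) q + interlacedCount m p (q + 1) + interlacedCount m p q := by
  rw [interlacedCount_succ]
  simp only [interlacedCount, ← sum_add_distrib]
  refine sum_congr rfl fun A hA ↦ sum_congr rfl fun B hB ↦ ?_
  rw [mem_powerset] at hA hB
  simp only [interlaced_succ hA hB, interlaced_succ_insert_right hA hB,
    interlaced_succ_insert_left hA hB, interlaced_succ_insert_insert hA hB]
  grind

lemma interlacedCount_succ_self (m p : ℕ) :
    interlacedCount (m + 1) (p + 1) (p + 1) =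
      interlacedCount m p (p + 1) + interlacedCount m p p := by
  rw [interlacedCount_succ]
  simp only [interlacedCount, ← sum_add_distrib]
  refine sum_congr rfl fun A hA ↦ sum_congr rfl fun B hB ↦ ?_
  rw [mem_powerset] at hA hB
  simp only [interlaced_succ hA hB, interlaced_succ_insert_right hA hB,
    interlaced_succ_insert_left hA hB, interlaced_succ_insert_insert hA hB]
  grind

lemma interlacedCount_zero (p q : ℕ) :
    interlacedCount 0 p q = if p = 0 ∧ q = 0 then 1 else 0 := by
  simp only [interlacedCount, Interlaced, range_zero, powerset_empty, sum_singleton, card_empty,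
    not_lt_zero, false_imp_iff, implies_true, and_true, @eq_comm _ 0]

lemma interlacedCount_zero_left (n q : ℕ) : interlacedCount (n + 1) 0 (q + 1) = n.choose q := by
  induction n generalizing q with
  | zero => cases q <;> simp [interlacedCount_zero_succ, interlacedCount_zero]
  | succ n ih =>
    cases q with
    | zero => simp [interlacedCount_zero_succ (n + 1), ih, interlacedCount_succ_zero_right]
    | succ q => rw [interlacedCount_zero_succ (n + 1), ih, ih, Nat.choose_succ_succ', add_comm]

/-- Ballot-type formula `C(n + 1, p + 1) C(n, q) - C(n + 1, p) C(n, q + 1)` for the number of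
interlaced pairs, in subtraction-free form. -/
lemma interlacedCount_add {n p q : ℕ} (h : p ≤ q) :
    interlacedCount (n + 1) (p + 1) (q + 1) + (n + 1).choose p * n.choose (q + 1) =
      (n + 1).choose (p + 1) * n.choose q := by
  induction n generalizing p q with
  | zero =>
    rcases h.eq_or_lt with rfl | h
    · cases p <;> simp [interlacedCount_succ_self, interlacedCount_zero]
    · obtain ⟨q, rfl⟩ := Nat.exists_eq_succ_of_ne_zero (by omega : q ≠ 0)
      simp [interlacedCount_succ_succ h, interlacedCount_zero]
  | succ n ih =>
    have key (p q) (h : p ≤ q) := ih h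
    rcases h.eq_or_lt with rfl | h
    · rw [interlacedCount_succ_self (n + 1)]
      cases p with
      | zero =>
        rw [interlacedCount_zero_left, interlacedCount_succ_zero_right]
        simp; omega
      | succ p =>
        have h1 := key p (p + 1) (by omega)
        have h2 := key p p le_rfl
        simp only [Nat.choose_succ_succ'] at *
        nlinarith
    · obtain ⟨q, rfl⟩ := Nat.exists_eq_succ_of_ne_zero (by omega : q ≠ 0)
      rw [Nat.succ_eq_add_one] at *
      rw [interlacedCount_succ_succ h]
      have h1 := key p (q + 1) (by omega)
      have h2 := key p q (by omega)
      cases p with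
      | zero =>
        rw [interlacedCount_zero_left, interlacedCount_zero_left]
        simp only [Nat.choose_succ_succ', Nat.choose_zero_right] at *
        nlinarith
      | succ p =>
        have h3 := key p (q + 1) (by omega)
        have h4 := key p q (by omega)
        simp only [Nat.choose_succ_succ'] at *
        nlinarith

lemma interlacedCount_eq {m k : ℕ} (hk1 : 1 ≤ k) (hkm : k ≤ m) :
    interlacedCount m k k = m.choose k * m.choose (k - 1) / m := by
  obtain ⟨k, rfl⟩ := Nat.exists_eq_add_of_le' hk1
  obtain ⟨n, rfl⟩ := Nat.exists_eq_add_of_le' (hk1.trans hkm)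
  have h := interlacedCount_add (n := n) (le_refl k)
  have h1 := Nat.add_one_mul_choose_eq n k
  have h2 := Nat.choose_succ_succ' n k
  have h3 := Nat.choose_succ_right_eq (n + 1) k
  rw [Nat.add_sub_cancel, eq_comm]
  apply Nat.div_eq_of_eq_mul_right n.succ_pos
  obtain ⟨d, rfl⟩ := Nat.exists_eq_add_of_le (Nat.le_of_succ_le_succ hkm)
  have h4 : (k + d + 1) - k = d + 1 := by omega
  rw [h4] at h3
  generalize interlacedCount _ _ _ = G at *
  zify at *
  linear_combination -((k : ℤ) + d + 1) * h - (((k + d + 1).choose (k + 1) : ℤ) +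
    (k + d + 1).choose k) * h1 - ((k : ℤ) + d + 1) * (k + d + 1).choose k * h2 -
    ((k + d + 1).choose (k + 1) : ℤ) * h3

section
variable {m : ℕ}

lemma interlaced_map_val {p q : ℕ} {A B : Finset (Fin m)} :
    Interlaced m p q (A.map Fin.valEmbedding) (B.map Fin.valEmbedding) ↔
      #A = p ∧ #B = q ∧ ∀ t : Fin m, #{a ∈ A | a < t} < #{b ∈ B | b ≤ t} := by
  simp only [Interlaced, card_map, filter_map, Fin.forall_iff, Function.comp_def,
    Fin.valEmbedding_apply, Fin.lt_def, Fin.le_def]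

open Classical in
/-- The positions of the right-to-left minima of `σ`. -/
noncomputable def minPositions (σ : Equiv.Perm (Fin m)) : Finset (Fin m) :=
  {a | IsRtLMin σ a}

lemma mem_minPositions {σ : Equiv.Perm (Fin m)} {a : Fin m} :
    a ∈ minPositions σ ↔ IsRtLMin σ a := by
  simp [minPositions]

lemma numRtLMin_eq_card (σ : Equiv.Perm (Fin m)) : numRtLMin σ = #(minPositions σ) := by
  classical rw [numRtLMin, Nat.card_eq_fintype_card, Fintype.card_subtype, minPositions]

lemma apply_le_of_forall_ge {σ : Equiv.Perm (Fin m)} {a t : Fin m}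
    (ht : ∀ b, t ≤ b → σ a ≤ σ b) : σ a ≤ t := by
  have : (Ici t).map σ.toEmbedding ⊆ Ici (σ a) := by
    intro x
    simp only [mem_map_equiv, mem_Ici]
    intro hx
    simpa using ht _ hx
  have := card_le_card this
  simp only [card_map, Fin.card_Ici] at this
  omega

lemma IsRtLMin.le_apply {σ : Equiv.Perm (Fin m)} {a : Fin m} (h : IsRtLMin σ a) {b : Fin m}
    (hb : a ≤ b) : σ a ≤ σ b :=
  hb.eq_or_lt.elim (fun h ↦ h ▸ le_rfl) fun hab ↦ (h b hab).le

lemma card_filter_minPositions_lt (σ : Equiv.Perm (Fin m)) (t : Fin m) :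
    #{a ∈ minPositions σ | a < t} < #{b ∈ (minPositions σ).map σ.toEmbedding | b ≤ t} := by
  obtain ⟨a, ha, hmin⟩ := exists_min_image (Ici t) σ ⟨t, by simp⟩
  rw [mem_Ici] at ha
  have hσa : IsRtLMin σ a := fun b hb ↦
    (hmin b (mem_Ici.2 (ha.trans hb.le))).lt_of_ne (σ.injective.ne hb.ne)
  have hsub : ({b ∈ minPositions σ | b < t} ∪ {a}).map σ.toEmbedding ⊆
      {b ∈ (minPositions σ).map σ.toEmbedding | b ≤ t} := by
    intro x hx
    simp only [mem_map, mem_union, mem_filter, mem_singleton, mem_minPositions] at hx ⊢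
    obtain ⟨b, ⟨hb, hbt⟩ | rfl, rfl⟩ := hx
    · exact ⟨⟨b, hb, rfl⟩, apply_le_of_forall_ge fun c hc ↦ hb.le_apply (hbt.le.trans hc)⟩
    · exact ⟨⟨b, hσa, rfl⟩, apply_le_of_forall_ge fun c hc ↦ hmin c (mem_Ici.2 hc)⟩
  have := card_le_card hsub
  rw [card_map, card_union_of_disjoint (by simp [ha]), card_singleton] at this
  omega

/-- Two sets of equal size are matched by a permutation which is increasing on the first set and on
its complement. -/
lemma exists_perm_strictMonoOn {A B : Finset (Fin m)} (h : #A = #B) :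
    ∃ σ : Equiv.Perm (Fin m), A.map σ.toEmbedding = B ∧ StrictMonoOn σ A ∧
      StrictMonoOn σ (Aᶜ : Finset (Fin m)) := by
  have hc : #Aᶜ = #Bᶜ := by rw [card_compl, card_compl, h]
  let e : A ≃o B := (A.orderIsoOfFin h).symm.trans (B.orderIsoOfFin rfl)
  let f : (Aᶜ : Finset (Fin m)) ≃o (Bᶜ : Finset (Fin m)) :=
    ((Aᶜ).orderIsoOfFin hc).symm.trans ((Bᶜ).orderIsoOfFin rfl)
  let g : {a // a ∉ A} ≃ {b // b ∉ B} :=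
    ((Equiv.subtypeEquivRight fun a ↦ by simp).trans f.toEquiv).trans
      (Equiv.subtypeEquivRight fun b ↦ by simp)
  let σ : Equiv.Perm (Fin m) := Equiv.subtypeCongr (p := (· ∈ A)) (q := (· ∈ B)) e.toEquiv g
  have hσ (a) (ha : a ∈ A) : σ a = e ⟨a, ha⟩ := by
    simp [σ, Equiv.subtypeCongr, ha]
  have hσ' (a) (ha : a ∉ A) : σ a = f ⟨a, by simpa using ha⟩ := by
    simp [σ, Equiv.subtypeCongr, ha, g]
    rfl
  refine ⟨σ, ?_, ?_, ?_⟩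
  · refine eq_of_subset_of_card_le (fun x hx ↦ ?_) (by rw [card_map, h])
    obtain ⟨a, ha, rfl⟩ := mem_map.1 hx
    simp [hσ a ha]
  · intro a ha b hb hab
    rw [hσ a ha, hσ b hb]
    exact e.strictMono hab
  · intro a ha b hb hab
    rw [hσ' a (by simpa using ha), hσ' b (by simpa using hb)]
    exact f.strictMono hab

lemma card_filter_lt_apply {σ : Equiv.Perm (Fin m)} {A : Finset (Fin m)} (h : StrictMonoOn σ A)
    {a : Fin m} (ha : a ∈ A) :
    #{b ∈ A.map σ.toEmbedding | b < σ a} = #{b ∈ A | b < a} := by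
  rw [filter_map, card_map]
  congr 1
  exact filter_congr fun b hb ↦ by simpa using h.lt_iff_lt hb ha

lemma card_filter_compl (A : Finset (Fin m)) (P : Fin m → Prop) [DecidablePred P] :
    #{a ∈ Aᶜ | P a} + #{a ∈ A | P a} = #{a | P a} := by
  rw [← card_union_of_disjoint, ← filter_union, union_comm, union_compl]
  exact disjoint_filter_filter disjoint_compl_left

lemma minPositions_eq {σ : Equiv.Perm (Fin m)} {A : Finset (Fin m)} (hA : StrictMonoOn σ A)
    (hA' : StrictMonoOn σ (Aᶜ : Finset (Fin m)))
    (h : ∀ t, #{a ∈ A | a < t} < #{b ∈ A.map σ.toEmbedding | b ≤ t}) :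
    minPositions σ = A := by
  have hle (a) (ha : a ∈ A) : σ a ≤ a := by
    by_contra! hlt
    have h1 := h a
    rw [← card_filter_lt_apply hA ha] at h1
    exact h1.not_ge (card_le_card (monotone_filter_right _ fun b _ hb ↦ hb.trans_lt hlt))
  have hcompl : (Aᶜ).map σ.toEmbedding = (A.map σ.toEmbedding)ᶜ := by
    ext; simp [mem_map_equiv]
  have hlt (a) (ha : a ∉ A) : a < σ a := by
    by_contra! hle
    have h1 := h a
    have h2 := card_filter_lt_apply hA' (mem_compl.2 ha)
    rw [hcompl] at h2
    have h3 := card_filter_compl A (· < a)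
    have h4 := card_filter_compl (A.map σ.toEmbedding) (· ≤ a)
    have h5 : #{b ∈ (A.map σ.toEmbedding)ᶜ | b < σ a} < #{b ∈ (A.map σ.toEmbedding)ᶜ | b ≤ a} := by
      refine card_lt_card ((ssubset_iff_of_subset
        (monotone_filter_right _ fun b _ hb ↦ hb.le.trans hle)).2 ⟨σ a, ?_, by simp⟩)
      simp [ha, hle]
    simp only [filter_gt_eq_Iio, filter_ge_eq_Iic, Fin.card_Iio, Fin.card_Iic] at h3 h4
    omega
  ext a
  rw [mem_minPositions]
  refine ⟨fun hmin ↦ ?_, fun ha b hab ↦ ?_⟩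
  · by_contra ha
    exact (hlt a ha).not_ge (apply_le_of_forall_ge fun c hc ↦ hmin.le_apply hc)
  · by_cases hb : b ∈ A
    · exact hA ha hb hab
    · exact ((hle a ha).trans_lt hab).trans (hlt b hb)

lemma RtLM_eq_image (σ : Equiv.Perm (Fin m)) :
    RtLM σ = (fun a ↦ (a, σ a)) '' (minPositions σ : Set (Fin m)) := by
  ext ⟨a, b⟩
  simp [RtLM, mem_minPositions, eq_comm, and_comm]

/-- The sets of first and of second coordinates of `S`, as sets of naturals. -/
noncomputable def coordinateSets (S : Set (Fin m × Fin m)) : Finset ℕ × Finset ℕ :=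
  ((Prod.fst '' S).toFinite.toFinset.map Fin.valEmbedding,
    (Prod.snd '' S).toFinite.toFinset.map Fin.valEmbedding)

lemma coordinateSets_RtLM (σ : Equiv.Perm (Fin m)) :
    coordinateSets (RtLM σ) = ((minPositions σ).map Fin.valEmbedding,
      ((minPositions σ).map σ.toEmbedding).map Fin.valEmbedding) := by
  simp only [coordinateSets, Prod.mk.injEq, map_inj]
  constructor <;> ext <;> simp [RtLM_eq_image, -mem_map_equiv]

lemma strictMonoOn_minPositions (σ : Equiv.Perm (Fin m)) : StrictMonoOn σ (minPositions σ) :=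
  fun _ ha b _ hab ↦ mem_minPositions.1 ha b hab

lemma RtLM_eq_of_coordinateSets_eq {σ τ : Equiv.Perm (Fin m)}
    (h : coordinateSets (RtLM σ) = coordinateSets (RtLM τ)) : RtLM σ = RtLM τ := by
  simp only [coordinateSets_RtLM, Prod.mk.injEq, map_inj] at h
  obtain ⟨hpos, hval⟩ := h
  rw [RtLM_eq_image, RtLM_eq_image, ← hpos]
  rw [← hpos] at hval
  have hσ := strictMonoOn_minPositions σ
  have hτ := strictMonoOn_minPositions τ
  rw [← hpos] at hτ
  have hrange : Set.range ((minPositions σ : Set (Fin m)).domRestrict σ) =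
      Set.range ((minPositions σ : Set (Fin m)).domRestrict τ) := by
    rw [Set.range_domRestrict, Set.range_domRestrict]
    simpa using congrArg (fun s : Finset (Fin m) ↦ (s : Set (Fin m))) hval
  have heq := (hσ.strictMono.range_inj hτ.strictMono).1 hrange
  exact Set.image_congr fun a ha ↦ congrArg (Prod.mk a) (congrFun heq ⟨a, ha⟩)

lemma exists_RtLM_iff {k : ℕ} (T : Finset ℕ × Finset ℕ) :
    (∃ σ : Equiv.Perm (Fin m), numRtLMin σ = k ∧ coordinateSets (RtLM σ) = T) ↔
      T.1 ⊆ range m ∧ T.2 ⊆ range m ∧ Interlaced m k k T.1 T.2 := by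
  have hmap (A : Finset ℕ) (hA : A ⊆ range m) :
      ∃ A' : Finset (Fin m), A'.map Fin.valEmbedding = A :=
    ⟨A.attachFin fun a ha ↦ mem_range.1 (hA ha), by simp⟩
  have hsub (A : Finset (Fin m)) : A.map Fin.valEmbedding ⊆ range m := by
    intro x hx
    obtain ⟨a, -, rfl⟩ := mem_map.1 hx
    simp
  constructor
  · rintro ⟨σ, hk, rfl⟩
    rw [coordinateSets_RtLM, interlaced_map_val, card_map, ← numRtLMin_eq_card]
    exact ⟨hsub _, hsub _, hk, hk, card_filter_minPositions_lt σ⟩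
  · obtain ⟨A, B⟩ := T
    rintro ⟨hA, hB, hAB⟩
    obtain ⟨A, rfl⟩ := hmap A hA
    obtain ⟨B, rfl⟩ := hmap B hB
    obtain ⟨hAk, hBk, h⟩ := interlaced_map_val.1 hAB
    obtain ⟨σ, rfl, hmono, hmono'⟩ := exists_perm_strictMonoOn (hAk.trans hBk.symm)
    have hpos := minPositions_eq hmono hmono' h
    exact ⟨σ, by rw [numRtLMin_eq_card, hpos, hAk], by rw [coordinateSets_RtLM, hpos]⟩

lemma card_RtLM_eq_interlacedCount (m k : ℕ) :
    Nat.card {S : Set (Fin m × Fin m) //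
        ∃ σ : Equiv.Perm (Fin m), numRtLMin σ = k ∧ RtLM σ = S} = interlacedCount m k k := by
  let 𝒮 : Set (Set (Fin m × Fin m)) := {S | ∃ σ, numRtLMin σ = k ∧ RtLM σ = S}
  have hinj : Set.InjOn coordinateSets 𝒮 := by
    rintro _ ⟨σ, -, rfl⟩ _ ⟨τ, -, rfl⟩ h
    exact RtLM_eq_of_coordinateSets_eq h
  have himage : coordinateSets '' 𝒮 =
      ({T ∈ (range m).powerset ×ˢ (range m).powerset | Interlaced m k k T.1 T.2} :
        Finset (Finset ℕ × Finset ℕ)) := by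
    ext T
    simp only [coe_filter, mem_product, mem_powerset, Set.mem_ofPred_eq, and_assoc,
      ← exists_RtLM_iff]
    constructor
    · rintro ⟨_, ⟨σ, hk, rfl⟩, hT⟩
      exact ⟨σ, hk, hT⟩
    · rintro ⟨σ, hk, hT⟩
      exact ⟨_, ⟨σ, hk, rfl⟩, hT⟩
  change Nat.card 𝒮 = _
  rw [Nat.card_coe_set_eq, ← hinj.ncard_image, himage, Set.ncard_coe_finset,
    interlacedCount, card_filter, sum_product]

end

end

theorem statement15 (m k : ℕ) (hm : 1 ≤ m) (hk1 : 1 ≤ k) (hkm : k ≤ m) :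
    Nat.card {S : Set (Fin m × Fin m) //
        ∃ σ : Equiv.Perm (Fin m), numRtLMin σ = k ∧ RtLM σ = S}
      = m.choose k * m.choose (k - 1) / m := by
  rw [card_RtLM_eq_interlacedCount, interlacedCount_eq hk1 hkm]

end Paper
end

section
/- The number of Dyck paths of semilength m with exactly k peaks equals the Narayana number N(m,k) = (1/m)·C(m,k)·C(m,k−1). -/
namespace Paper

/-- Paths of length `n` from height `h` down to `0` that stay nonnegative and have `k` peaks when
preceded by the step `b`. -/
def descents (b : Bool) (h : ℤ) (k n : ℕ) : Set (List Bool) :=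
  {l | l.length = n ∧ h + pathVal l = 0 ∧ (∀ p, p <+: l → 0 ≤ h + pathVal p) ∧ peaks (b :: l) = k}

theorem pathVal_cons (b : Bool) (l : List Bool) :
    pathVal (b :: l) = (if b then 1 else -1) + pathVal l := by
  simp [pathVal]

theorem neg_length_le_pathVal (l : List Bool) : -(l.length : ℤ) ≤ pathVal l := by
  induction l with
  | nil => simp [pathVal]
  | cons b l ih => rw [pathVal_cons]; cases b <;> simp <;> omega

theorem peaks_singleton (b : Bool) : peaks [b] = 0 := by
  cases b <;> rfl

theorem peaks_cons_cons (b c : Bool) (l : List Bool) :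
    peaks (b :: c :: l) = (if b && !c then 1 else 0) + peaks (c :: l) := by
  unfold peaks
  rw [List.length_cons, List.range_succ_eq_map, List.filter_cons, List.filter_map]
  cases b <;> cases c <;> simp [Function.comp_def]; omega

theorem peaks_false_cons (l : List Bool) : peaks (false :: l) = peaks l := by
  cases l with
  | nil => rfl
  | cons c l => simp [peaks_cons_cons]

theorem forall_prefix_cons_nonneg_iff (b : Bool) (h : ℤ) (l : List Bool) :
    (∀ p, p <+: b :: l → 0 ≤ h + pathVal p) ↔
      0 ≤ h ∧ ∀ p, p <+: l → 0 ≤ h + (if b then 1 else -1) + pathVal p := by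
  constructor
  · intro H
    refine ⟨by simpa [pathVal] using H [] List.nil_prefix, fun p hp => ?_⟩
    have := H (b :: p) (by simpa using hp)
    rw [pathVal_cons] at this
    omega
  · rintro ⟨h0, H⟩ p hp
    cases p with
    | nil => simpa [pathVal] using h0
    | cons c p =>
      obtain ⟨rfl, hpl⟩ := List.cons_prefix_cons.1 hp
      have := H p hpl
      rw [pathVal_cons]
      omega

theorem finite_descents (b : Bool) (h : ℤ) (k n : ℕ) : (descents b h k n).Finite :=
  (List.finite_length_eq Bool n).subset fun _ hl => hl.1

theorem descents_eq_empty_of_neg (b : Bool) {h : ℤ} (k n : ℕ) (hh : h < 0) :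
    descents b h k n = ∅ := by
  refine Set.eq_empty_of_forall_notMem fun l hl => ?_
  have := hl.2.2.1 [] List.nil_prefix
  simp [pathVal] at this
  omega

theorem descents_eq_empty_of_lt (b : Bool) {h : ℤ} (k n : ℕ) (hh : (n : ℤ) < h) :
    descents b h k n = ∅ := by
  refine Set.eq_empty_of_forall_notMem fun l hl => ?_
  have := neg_length_le_pathVal l
  have := hl.1
  have := hl.2.1
  omega

theorem cons_mem_descents (b c : Bool) {h : ℤ} (hh : 0 ≤ h) (k n : ℕ) (l : List Bool) :
    c :: l ∈ descents b h k (n + 1) ↔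
      l.length = n ∧ h + (if c then 1 else -1) + pathVal l = 0 ∧
      (∀ p, p <+: l → 0 ≤ h + (if c then 1 else -1) + pathVal p) ∧
      (if b && !c then 1 else 0) + peaks (c :: l) = k := by
  simp only [descents, Set.mem_ofPred_eq, forall_prefix_cons_nonneg_iff, pathVal_cons,
    peaks_cons_cons, List.length_cons, add_assoc, hh, true_and, Nat.add_right_cancel_iff]

theorem ncard_union_cons (A B : Set (List Bool)) (hA : A.Finite) (hB : B.Finite) :
    (Set.image (List.cons true) A ∪ Set.image (List.cons false) B).ncard = A.ncard + B.ncard := by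
  rw [Set.ncard_union_eq _ (hA.image _) (hB.image _),
    Set.ncard_image_of_injective _ List.cons_injective,
    Set.ncard_image_of_injective _ List.cons_injective]
  rw [Set.disjoint_left]
  rintro _ ⟨x, -, rfl⟩ ⟨y, -, h⟩
  simp at h

theorem ncard_descents_false_succ {h : ℤ} (hh : 0 ≤ h) (k n : ℕ) :
    (descents false h k (n + 1)).ncard =
      (descents true (h + 1) k n).ncard + (descents false (h - 1) k n).ncard := by
  rw [← ncard_union_cons _ _ (finite_descents ..) (finite_descents ..)]
  congr 1
  ext l
  rcases l with _ | ⟨_ | _, l⟩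
  · simp [descents]
  · rw [cons_mem_descents _ _ hh]
    simp [descents, sub_eq_add_neg]
  · rw [cons_mem_descents _ _ hh]
    simp [descents]

theorem ncard_descents_true_succ {h : ℤ} (hh : 0 ≤ h) (k n : ℕ) :
    (descents true h (k + 1) (n + 1)).ncard =
      (descents true (h + 1) (k + 1) n).ncard + (descents false (h - 1) k n).ncard := by
  rw [← ncard_union_cons _ _ (finite_descents ..) (finite_descents ..)]
  congr 1
  ext l
  rcases l with _ | ⟨_ | _, l⟩
  · simp [descents]
  · rw [cons_mem_descents _ _ hh]
    simp [descents, sub_eq_add_neg, add_comm 1]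
  · rw [cons_mem_descents _ _ hh]
    simp [descents]

theorem ncard_descents_true_zero_succ {h : ℤ} (hh : 0 ≤ h) (n : ℕ) :
    (descents true h 0 (n + 1)).ncard = (descents true (h + 1) 0 n).ncard := by
  rw [← Set.ncard_image_of_injective (descents true (h + 1) 0 n)
    (List.cons_injective (a := true))]
  congr 1
  ext l
  rcases l with _ | ⟨_ | _, l⟩
  · simp [descents]
  · rw [cons_mem_descents _ _ hh]
    simp
  · rw [cons_mem_descents _ _ hh]
    simp [descents]

/-- The number of nonnegative paths from height `h` to `0` with `u` up-steps and `k` peaks. -/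
def descentCount (h : ℕ) : ℕ → ℕ → ℤ
  | 0, 0 => 1
  | 0, _ + 1 => 0
  | _ + 1, 0 => 0
  | u + 1, j + 1 =>
    u.choose j * (u + h + 1).choose (j + 1) - u.choose (j + 1) * (u + h + 1).choose j

/-- The number of nonnegative paths from height `h + 1` to `0` with `u` up-steps and `k` peaks,
where the path is preceded by an up-step. -/
def descentCountAfterUp (h u : ℕ) : ℕ → ℤ
  | 0 => 0
  | 1 => 1
  | j + 2 => u.choose (j + 1) * (u + h).choose (j + 1) - u.choose (j + 2) * (u + h).choose j

theorem descentCount_zero_succ (u k : ℕ) :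
    descentCount 0 (u + 1) k = descentCountAfterUp 0 u k := by
  rcases k with _ | _ | j
  · rfl
  · simp [descentCount, descentCountAfterUp]
  · simp only [descentCount, descentCountAfterUp, add_zero, Nat.choose_succ_succ]
    push_cast
    ring

theorem descentCount_succ_succ (h u k : ℕ) :
    descentCount (h + 1) (u + 1) k =
      descentCountAfterUp (h + 1) u k + descentCount h (u + 1) k := by
  rcases k with _ | _ | j
  · rfl
  · simp [descentCount, descentCountAfterUp]
    ring
  · simp only [descentCount, descentCountAfterUp, ← add_assoc, Nat.choose_succ_succ]
    push_cast
    ring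

theorem descentCountAfterUp_succ (h u k : ℕ) :
    descentCountAfterUp h (u + 1) (k + 1) =
      descentCountAfterUp (h + 1) u (k + 1) + descentCount h (u + 1) k := by
  rcases k with _ | _ | j
  · simp [descentCount, descentCountAfterUp]
  · simp [descentCount, descentCountAfterUp, Nat.choose_succ_succ]
    ring
  · rw [show descentCountAfterUp h (u + 1) (j + 2 + 1) = _ from rfl]
    simp only [descentCount, descentCountAfterUp,
      show u + (h + 1) = u + h + 1 by omega, show u + 1 + h = u + h + 1 by omega,
      Nat.choose_succ_succ u]
    push_cast
    ring

theorem descentCountAfterUp_zero (h k : ℕ) :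
    descentCountAfterUp h 0 (k + 1) = descentCount h 0 k := by
  rcases k with _ | j
  · rfl
  · simp [descentCount, descentCountAfterUp]

theorem descentCount_zero_right (g h k : ℕ) : descentCount g 0 k = descentCount h 0 k := by
  cases k <;> rfl

theorem ncard_descents (n : ℕ) :
    (∀ u h k : ℕ, n = 2 * u + h → ((descents false h k n).ncard : ℤ) = descentCount h u k) ∧
    (∀ u h k : ℕ, n = 2 * u + h + 1 →
      ((descents true (h + 1) k n).ncard : ℤ) = descentCountAfterUp h u k) := by
  induction n with
  | zero =>
    refine ⟨fun u h k e => ?_, fun u h k e => by omega⟩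
    obtain ⟨rfl, rfl⟩ : u = 0 ∧ h = 0 := by omega
    rcases k with _ | k
    · have : descents false (0 : ℕ) 0 0 = {[]} := by
        ext l
        cases l <;> simp [descents, pathVal, peaks_singleton]
      rw [this]
      simp [descentCount]
    · have : descents false (0 : ℕ) (k + 1) 0 = ∅ := by
        ext l
        cases l <;> simp [descents, peaks_singleton]
      rw [this]
      simp [descentCount]
  | succ n ih =>
    obtain ⟨ihD, ihU⟩ := ih
    refine ⟨fun u h k e => ?_, fun u h k e => ?_⟩
    · rw [ncard_descents_false_succ (by omega)]
      push_cast
      rcases u with _ | u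
      · obtain ⟨h, rfl⟩ : ∃ g, h = g + 1 := ⟨h - 1, by omega⟩
        rw [descents_eq_empty_of_lt true _ _ (by omega), descentCount_zero_right _ h,
          ← ihD 0 h k (by omega)]
        simp
      · rw [ihU u h k (by omega)]
        rcases h with _ | h
        · rw [descents_eq_empty_of_neg false _ _ (by omega), descentCount_zero_succ]
          simp
        · rw [descentCount_succ_succ, ← ihD (u + 1) h k (by omega)]
          simp
    · rcases k with _ | k
      · rw [ncard_descents_true_zero_succ (by omega)]
        rcases u with _ | u
        · rw [descents_eq_empty_of_lt true _ _ (by omega)]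
          simp [descentCountAfterUp]
        · exact_mod_cast ihU u (h + 1) 0 (by omega)
      · rw [ncard_descents_true_succ (by omega), add_sub_cancel_right]
        push_cast
        rw [ihD u h k (by omega)]
        rcases u with _ | u
        · rw [descents_eq_empty_of_lt true _ _ (by omega), descentCountAfterUp_zero]
          simp
        · rw [descentCountAfterUp_succ, ← ihU u (h + 1) (k + 1) (by omega)]
          push_cast
          rfl

theorem succ_mul_descentCount_zero (u j : ℕ) (hj : j ≤ u) :
    ((u + 1 : ℕ) : ℤ) * descentCount 0 (u + 1) (j + 1) =
      (u + 1).choose (j + 1) * (u + 1).choose j := by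
  have h₁ := Nat.add_one_mul_choose_eq u j
  have h₂ := Nat.choose_succ_right_eq (u + 1) j
  have h₃ := Nat.choose_mul_succ_eq u (j + 1)
  rw [Nat.add_sub_add_right] at h₃
  zify [hj, Nat.le_succ_of_le hj] at h₁ h₂ h₃
  simp only [descentCount, add_zero]
  push_cast
  linear_combination ((u + 1).choose (j + 1) : ℤ) * h₁ - ((u + 1).choose j : ℤ) * h₃
    + ((u + 1).choose (j + 1) : ℤ) * h₂

theorem statement17 (m k : ℕ) (hk1 : 1 ≤ k) (hkm : k ≤ m) :
    Nat.card {l : List Bool // l.length = 2 * m ∧ IsDyckPath l ∧ peaks l = k}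
      = m.choose k * m.choose (k - 1) / m := by
  obtain ⟨j, rfl⟩ : ∃ j, k = j + 1 := ⟨k - 1, by omega⟩
  obtain ⟨u, rfl⟩ : ∃ u, m = u + 1 := ⟨m - 1, by omega⟩
  have hset : {l : List Bool | l.length = 2 * (u + 1) ∧ IsDyckPath l ∧ peaks l = j + 1} =
      descents false (0 : ℕ) (j + 1) (2 * (u + 1)) := by
    ext l
    simp [descents, IsDyckPath, peaks_false_cons, and_assoc]
  have hcount := (ncard_descents (2 * (u + 1))).1 (u + 1) 0 (j + 1) rfl
  rw [← hset] at hcount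
  have hmul := succ_mul_descentCount_zero u j (by omega)
  rw [← hcount] at hmul
  refine (Nat.div_eq_of_eq_mul_right (Nat.succ_pos u) ?_).symm
  exact_mod_cast hmul.symm

end Paper
end
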